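/- arXiv:2210.13203 — 2 statements merged into one kernel-verified Lean document; each statement's English description precedes it below -/
import Mathlib

section
/- Let Γ be a countable amenable group and α a minimal action of Γ by homeomorphisms on a compact metrizable 0-dimensional space X. Then the topological full group ⟦α⟧ admits a dense locally finite subgroup if and only if T(α) is unperforated. -/
open MeasureTheory Set
open scoped ENNReal

/-! Preliminary definitions: the clopen type semigroup of an action of a group `Γ`
by homeomorphisms on a topological space `X`, invariant measures, dynamical comparison,
topological full groups, and the topology on spaces of actions. -/

/-- The group of self-homeomorphisms of `X`, with `(g * h) x = g (h x)`. -/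
instance homeoGroup (X : Type*) [TopologicalSpace X] : Group (X ≃ₜ X) where
  mul g h := h.trans g
  one := Homeomorph.refl X
  inv := Homeomorph.symm
  mul_assoc a b c := Homeomorph.ext fun _ => rfl
  one_mul a := Homeomorph.ext fun _ => rfl
  mul_one a := Homeomorph.ext fun _ => rfl
  inv_mul_cancel a := Homeomorph.ext fun x => a.symm_apply_apply x

/-- The Cantor space `{0,1}^ℕ`. -/
abbrev Cantor : Type := ℕ → Bool

section Defs

variable {Γ : Type*} [Group Γ] {X : Type*} [TopologicalSpace X]

/-- A left-invariant finitely additive probability measure on (the power set of) `Γ`,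
with values in `[0,1]`. `Γ` is amenable iff such a measure exists. -/
def IsInvFapm {Γ : Type*} [Group Γ] (m : Set Γ → ℝ) : Prop :=
  (∀ E : Set Γ, 0 ≤ m E) ∧ (∀ E : Set Γ, m E ≤ 1) ∧ m Set.univ = 1 ∧
  (∀ E F : Set Γ, Disjoint E F → m (E ∪ F) = m E + m F) ∧
  (∀ (γ : Γ) (E : Set Γ), m ((γ * ·) '' E) = m E)

/-- The action of `γ ∈ Γ` on continuous `ℕ`-valued functions: `(γ · f)(x) = f(γ⁻¹ · x)`. -/
def actC (α : Γ →* X ≃ₜ X) (γ : Γ) (f : C(X, ℕ)) : C(X, ℕ) :=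
  f.comp (α γ⁻¹)

/-- The equidecomposability relation `∼` on `C(X, ℕ)`: `f ∼ g` iff `f = h₁ + ⋯ + hₙ`
and `g = γ₁·h₁ + ⋯ + γₙ·hₙ` for some `hᵢ ∈ C(X,ℕ)`, `γᵢ ∈ Γ`. -/
def TypeRel (α : Γ →* X ≃ₜ X) (f g : C(X, ℕ)) : Prop :=
  ∃ (n : ℕ) (h : Fin n → C(X, ℕ)) (γ : Fin n → Γ),
    f = ∑ i, h i ∧ g = ∑ i, actC α (γ i) (h i)

/-- The additive congruence on `C(X, ℕ)` generated by `∼` (since `∼` is itself an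
additive congruence, this is just `∼`). -/
def typeCon (α : Γ →* X ≃ₜ X) : AddCon C(X, ℕ) := addConGen (TypeRel α)

/-- The clopen type semigroup `T(α) = C(X,ℕ)/∼`. -/
abbrev TypeSemigroup (α : Γ →* X ≃ₜ X) := (typeCon α).Quotient

/-- The class `[f] ∈ T(α)` of `f ∈ C(X, ℕ)`. -/
def cls (α : Γ →* X ≃ₜ X) (f : C(X, ℕ)) : TypeSemigroup α := (typeCon α).toQuotient f

/-- The algebraic preorder on `T(α)`: `a ≤ b` iff `a + c = b` for some `c`. -/
def tle (α : Γ →* X ≃ₜ X) (a b : TypeSemigroup α) : Prop := ∃ c, a + c = b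

/-- `T(α)` is unperforated: `n • a ≤ n • b` implies `a ≤ b` for all `n ≥ 1`. -/
def IsUnperforated (α : Γ →* X ≃ₜ X) : Prop :=
  ∀ (a b : TypeSemigroup α) (n : ℕ), 1 ≤ n → tle α (n • a) (n • b) → tle α a b

/-- `T(α)` is almost unperforated: `(n+1) • a ≤ n • b` implies `a ≤ b`. -/
def IsAlmostUnperforated (α : Γ →* X ≃ₜ X) : Prop :=
  ∀ (a b : TypeSemigroup α) (n : ℕ), tle α ((n + 1) • a) (n • b) → tle α a b

/-- `T(α)` is cancellative: `a + b = a + c` implies `b = c`. -/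
def IsCancellative (α : Γ →* X ≃ₜ X) : Prop :=
  ∀ a b c : TypeSemigroup α, a + b = a + c → b = c

/-- The algebraic preorder on `T(α)` is a partial order, i.e. it is antisymmetric. -/
def TleAntisymm (α : Γ →* X ≃ₜ X) : Prop :=
  ∀ a b : TypeSemigroup α, tle α a b → tle α b a → a = b

/-- `b` is an order unit of `T(α)`: every `a` satisfies `a ≤ k • b` for some `k ∈ ℕ`. -/
def IsOrderUnit (α : Γ →* X ≃ₜ X) (b : TypeSemigroup α) : Prop :=
  ∀ a : TypeSemigroup α, ∃ k : ℕ, tle α a (k • b)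

/-- A state on `T(α)`: an additive map to `[0,∞]` sending `0` to `0`. -/
def IsState (α : Γ →* X ≃ₜ X) (ν : TypeSemigroup α → ℝ≥0∞) : Prop :=
  ν 0 = 0 ∧ ∀ a b : TypeSemigroup α, ν (a + b) = ν a + ν b

/-- `M(α)`: the set of `Γ`-invariant Radon (regular Borel) probability measures on `X`. -/
def invRadon (α : Γ →* X ≃ₜ X) : Set (@Measure X (borel X)) :=
  letI : MeasurableSpace X := borel X
  {μ : Measure X | IsProbabilityMeasure μ ∧ μ.Regular ∧ ∀ γ : Γ, Measure.map ⇑(α γ) μ = μ}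

/-- The set of `Γ`-invariant Borel probability measures on `X`. -/
def invBorel (α : Γ →* X ≃ₜ X) : Set (@Measure X (borel X)) :=
  letI : MeasurableSpace X := borel X
  {μ : Measure X | IsProbabilityMeasure μ ∧ ∀ γ : Γ, Measure.map ⇑(α γ) μ = μ}

/-- `μ([f]) = ∫ f dμ`, the value of (the state associated with) a measure on the class of
`f ∈ C(X, ℕ)`. -/
noncomputable def intOf {X : Type*} [TopologicalSpace X] (μ : @Measure X (borel X))
    (f : C(X, ℕ)) : ℝ :=
  letI : MeasurableSpace X := borel X
  ∫ x, (f x : ℝ) ∂μ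

/-- `A` is subequidecomposable to `B`: there are a partition `A = A₁ ⊔ ⋯ ⊔ Aₙ` into clopen
sets and `γ₁, …, γₙ ∈ Γ` with `γ₁A₁, …, γₙAₙ` pairwise disjoint and contained in `B`. -/
def Subequidecomposable (α : Γ →* X ≃ₜ X) (A B : Set X) : Prop :=
  ∃ (n : ℕ) (P : Fin n → Set X) (γ : Fin n → Γ),
    (∀ i, IsClopen (P i)) ∧ (Pairwise fun i j => Disjoint (P i) (P j)) ∧
    (⋃ i, P i) = A ∧
    (Pairwise fun i j => Disjoint (⇑(α (γ i)) '' P i) (⇑(α (γ j)) '' P j)) ∧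
    ∀ i, ⇑(α (γ i)) '' P i ⊆ B

/-- Dynamical comparison (with respect to invariant Radon probability measures): for all
clopen `A`, `B` with `B` nonempty and `μ(A) < μ(B)` for every `μ ∈ M(α)`, `A` is
subequidecomposable to `B`. -/
def DynComparison (α : Γ →* X ≃ₜ X) : Prop :=
  ∀ A B : Set X, IsClopen A → IsClopen B → B.Nonempty →
    (∀ μ ∈ invRadon α, μ A < μ B) → Subequidecomposable α A B

/-- Dynamical comparison (with respect to invariant Borel probability measures). -/
def DynComparisonBorel (α : Γ →* X ≃ₜ X) : Prop :=
  ∀ A B : Set X, IsClopen A → IsClopen B → B.Nonempty →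
    (∀ μ ∈ invBorel α, μ A < μ B) → Subequidecomposable α A B

/-- The action `α` is minimal: the only closed invariant subsets are `∅` and `X`. -/
def IsMinimalAction (α : Γ →* X ≃ₜ X) : Prop :=
  ∀ F : Set X, IsClosed F → (∀ γ : Γ, ⇑(α γ) '' F ⊆ F) → F = ∅ ∨ F = Set.univ

/-- Membership in the topological full group `⟦α⟧`: `g` coincides with elements of the
action on the pieces of a finite clopen partition of `X`. -/
def InTopFullGroup (α : Γ →* X ≃ₜ X) (g : X ≃ₜ X) : Prop :=
  ∃ (n : ℕ) (P : Fin n → Set X) (γ : Fin n → Γ),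
    (∀ i, IsClopen (P i)) ∧ (Pairwise fun i j => Disjoint (P i) (P j)) ∧
    (⋃ i, P i) = Set.univ ∧ ∀ i, ∀ x ∈ P i, g x = α (γ i) x

/-- `⟦α⟧` admits a dense locally finite subgroup: there is a subgroup `Λ` of `Homeo(X)`
contained in `⟦α⟧`, locally finite (all its finitely generated subgroups are finite), and
dense in `⟦α⟧` for the topology whose basic neighborhoods of `h` are
`{g : g A = h A for all A ∈ 𝒜}`, `𝒜` ranging over finite clopen partitions of `X`. -/
def HasDenseLocallyFiniteSubgroup (α : Γ →* X ≃ₜ X) : Prop :=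
  ∃ Λ : Subgroup (X ≃ₜ X),
    ((Λ : Set (X ≃ₜ X)) ⊆ {g | InTopFullGroup α g}) ∧
    (∀ s : Finset (X ≃ₜ X), (s : Set (X ≃ₜ X)) ⊆ (Λ : Set (X ≃ₜ X)) →
      ((Subgroup.closure (s : Set (X ≃ₜ X)) : Subgroup (X ≃ₜ X)) : Set (X ≃ₜ X)).Finite) ∧
    ∀ g : X ≃ₜ X, InTopFullGroup α g →
      ∀ (n : ℕ) (P : Fin n → Set X), (∀ i, IsClopen (P i)) →
        (Pairwise fun i j => Disjoint (P i) (P j)) → (⋃ i, P i) = Set.univ →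
        ∃ l ∈ Λ, ∀ i, ⇑l '' P i = ⇑g '' P i

end Defs

/-- The topology on `Homeo(X)` whose basic neighborhoods of `h` are the sets
`{g : g A = h A for all A ∈ 𝒜}`, for `𝒜` a finite clopen partition of `X`; equivalently,
the topology generated by the sets `{g : g '' A = B}` for `A`, `B` clopen. -/
def homeoTop (X : Type*) [TopologicalSpace X] : TopologicalSpace (X ≃ₜ X) :=
  TopologicalSpace.generateFrom
    {U | ∃ A B : Set X, IsClopen A ∧ IsClopen B ∧ U = {g : X ≃ₜ X | ⇑g '' A = B}}

/-- The topology on the space `A(Γ)` of actions of `Γ` on `X`, induced from the product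
topology on `Homeo(X)^Γ`. -/
def actionTop (Γ : Type*) [Group Γ] (X : Type*) [TopologicalSpace X] :
    TopologicalSpace (Γ →* (X ≃ₜ X)) :=
  letI := homeoTop X
  TopologicalSpace.induced (fun φ : Γ →* (X ≃ₜ X) => ⇑φ) Pi.topologicalSpace


section AbstractMonoid

universe u v

/-- Abstract properties of the type semigroup. -/
structure GoodMon (T : Type u) [AddCommMonoid T] : Prop where
  refine' : ∀ a b c d : T, a + b = c + d →
    ∃ p q r s, a = p + q ∧ b = r + s ∧ c = p + r ∧ d = q + s
  simple : ∀ a b : T, b ≠ 0 → ∃ (k : ℕ) (c : T), a + c = k • b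
  fin : ∀ (b c : T) (k : ℕ), (k + 1) • b + c = k • b → b = 0
  unperf : ∀ (a b : T) (n : ℕ), 1 ≤ n → (∃ c, n • a + c = n • b) → ∃ c, a + c = b

variable {T : Type u} [AddCommMonoid T]

theorem riesz_gen (href : ∀ a b c d : T, a + b = c + d →
    ∃ p q r s, a = p + q ∧ b = r + s ∧ c = p + r ∧ d = q + s)
    (hcon : ∀ a b : T, a + b = 0 → a = 0) {ι : Type v} (s : Finset ι) (D : ι → T) :
    ∀ d c : T, d + c = ∑ j ∈ s, D j →
      ∃ e f : ι → T, d = ∑ j ∈ s, e j ∧ c = ∑ j ∈ s, f j ∧ ∀ j ∈ s, D j = e j + f j := by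
  classical
  induction s using Finset.induction_on with
  | empty =>
    rintro d c hc
    rw [Finset.sum_empty] at hc
    exact ⟨fun _ => 0, fun _ => 0, by simpa using hcon _ _ hc,
      by simpa using hcon c d (by rw [add_comm, hc]), by simp⟩
  | insert a s ha ih =>
    rintro d c hc
    rw [Finset.sum_insert ha] at hc
    obtain ⟨p, q, r, t, h1, h2, h3, h4⟩ := href _ _ _ _ hc
    obtain ⟨e, f, he, hf', hf⟩ := ih q t h4.symm
    have hsum : ∀ (e : ι → T) (p : T), ∑ j ∈ s, Function.update e a p j = ∑ j ∈ s, e j := by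
      intro e p
      apply Finset.sum_congr rfl
      intro j hj
      rw [Function.update_of_ne]
      rintro rfl; exact ha hj
    refine ⟨Function.update e a p, Function.update f a r, ?_, ?_, ?_⟩
    · rw [Finset.sum_insert ha, Function.update_self, h1, he, hsum]
    · rw [Finset.sum_insert ha, Function.update_self, h2, hf', hsum]
    · intro j hj
      by_cases hja : j = a
      · subst hja; simpa using h3
      · rw [Function.update_of_ne hja, Function.update_of_ne hja]
        exact hf j (Finset.mem_of_mem_insert_of_ne hj hja)

theorem GoodMon.conical (G : GoodMon T) {a b : T} (h : a + b = 0) : a = 0 :=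
  G.fin a b 0 (by simpa using h)

theorem GoodMon.absorb (G : GoodMon T) {a c : T} (h : a + c = a) : c = 0 := by
  by_contra hc
  obtain ⟨k, s, hs⟩ := G.simple a c hc
  have hn : ∀ n : ℕ, a + n • c = a := by
    intro n
    induction n with
    | zero => simp
    | succ n ih => rw [succ_nsmul, ← add_assoc, ih, h]
  apply hc
  apply G.fin c (a + s) k
  rw [← hs, ← add_assoc, add_comm _ a, hn]

theorem GoodMon.antisymm (G : GoodMon T) {a b : T} (h : ∃ c, a + c = b) (h' : ∃ c, b + c = a) :
    a = b := by
  obtain ⟨c, rfl⟩ := h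
  obtain ⟨d, hd⟩ := h'
  have := G.absorb (a := a) (c := c + d) (by rw [← add_assoc]; exact hd)
  rw [G.conical this, add_zero]

theorem GoodMon.canc (G : GoodMon T) {a b c : T} (h : a + b = a + c) : b = c := by
  by_cases hb : b = 0
  · subst hb
    rw [add_zero] at h
    exact (G.absorb h.symm).symm
  have key : ∀ n : ℕ, (∃ x y z w : T, b = z + w ∧ c = y + w ∧ x + y = x + z ∧ w ≠ 0) ∨
      ∃ x, a = x + n • b ∧ x + b = x + c := by
    intro n
    induction n with
    | zero => right; exact ⟨a, by simp, h⟩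
    | succ n ih =>
      rcases ih with ih | ⟨x, hx, hx'⟩
      · exact Or.inl ih
      · obtain ⟨p, q, r, s, h1, h2, h3, h4⟩ := G.refine' _ _ _ _ hx'
        by_cases hs : s = 0
        · right
          subst hs
          rw [add_zero] at h2 h4
          subst h2 h4
          refine ⟨p, ?_, by rw [← h3, h1]⟩
          rw [hx, h3, succ_nsmul, add_assoc, add_comm b]
        · left
          exact ⟨p, q, r, s, h2, h4, by rw [← h1, ← h3], hs⟩
  obtain ⟨k, s, hs⟩ := G.simple a b hb
  rcases key (k + 1) with ⟨x, y, z, w, h1, h2, h3, hw⟩ | ⟨x, hx, -⟩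
  · obtain ⟨n, t, ht⟩ := G.simple x w hw
    have hn1 : ∀ n : ℕ, x + n • y = x + n • z := by
      intro n
      induction n with
      | zero => simp
      | succ n ih =>
        rw [succ_nsmul, succ_nsmul, ← add_assoc, ih, add_assoc, add_comm _ y, ← add_assoc, h3,
          add_assoc, add_comm z]
    have hn0 : 1 ≤ n + 1 := by omega
    have e : (n + 1) • b = (n + 1) • c := by
      have ht' : x + (t + w) = (n + 1) • w := by rw [succ_nsmul, ← ht, add_assoc]
      rw [h1, h2, nsmul_add, nsmul_add, ← ht', ← add_assoc, ← add_assoc _ x, add_comm _ x,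
        add_comm _ x, hn1]
    exact G.antisymm (G.unperf b c (n + 1) hn0 ⟨0, by rw [add_zero, e]⟩)
      (G.unperf c b (n + 1) hn0 ⟨0, by rw [add_zero, e]⟩)
  · exfalso
    apply hb
    apply G.fin b (x + s) k
    rw [← hs, hx, add_left_comm, add_assoc]

/-- Shen's property, conclusion. -/
def ShenC {ι : Type v} [Fintype ι] (d : ι → T) (w : ι → ℤ) : Prop :=
  ∃ (l : ℕ) (e : Fin l → T) (M : ι → Fin l → ℕ),
    (∀ i, d i = ∑ j, M i j • e j) ∧ ∀ j, ∑ i, w i * (M i j : ℤ) = 0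

theorem GoodMon.shen_step (G : GoodMon T) {ι : Type v} [Fintype ι] [DecidableEq ι]
    (N : ℕ) (hN : 1 ≤ N) (d : ι → T) (w : ι → ℤ) (hw : ∀ i, |w i| ≤ N) (i0 : ι) (hi0 : w i0 = N)
    (heq : ∑ i, (w i).toNat • d i = ∑ i, (-w i).toNat • d i)
    (IH : ∀ (d' : ι ⊕ ι → T) (w' : ι ⊕ ι → ℤ), (∀ i, |w' i| ≤ N) →
      (Finset.univ.filter fun i => |w' i| = N).card <
        (Finset.univ.filter fun i => |w i| = N).card →
      (∑ i, (w' i).toNat • d' i = ∑ i, (-w' i).toNat • d' i) → ShenC d' w') :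
    ShenC d w := by
  have hle : ∃ c, d i0 + c = ∑ j, (if w j < 0 then d j else 0) := by
    apply G.unperf _ _ N hN
    refine ⟨∑ i ∈ Finset.univ.erase i0, (w i).toNat • d i +
      ∑ i, (if w i < 0 then (N - (-w i).toNat) • d i else 0), ?_⟩
    rw [← add_assoc]
    have : N • d i0 + ∑ i ∈ Finset.univ.erase i0, (w i).toNat • d i =
        ∑ i, (w i).toNat • d i := by
      rw [← Finset.add_sum_erase _ _ (Finset.mem_univ i0), hi0]; simp
    rw [this, heq, Finset.smul_sum, ← Finset.sum_add_distrib]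
    apply Finset.sum_congr rfl
    intro i _
    have := abs_le.1 (hw i)
    split_ifs with h
    · rw [← add_nsmul]; congr 1; omega
    · rw [Int.toNat_of_nonpos (by omega)]; simp
  obtain ⟨c0, hle⟩ := hle
  obtain ⟨e, f, he, -, hf⟩ := riesz_gen G.refine' (fun _ _ => G.conical) Finset.univ _ _ _ hle
  have hf1 : ∀ j, w j < 0 → d j = e j + f j := by
    intro j hj; simpa [hj] using hf j (Finset.mem_univ j)
  have hf2 : ∀ j, ¬ w j < 0 → e j = 0 := by
    intro j hj
    have := hf j (Finset.mem_univ j)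
    rw [if_neg hj] at this
    exact G.conical this.symm
  let F : ι → T := fun i => if i = i0 then 0 else if w i < 0 then f i else d i
  let wl : ι → ℤ := fun i => if i = i0 then 0 else w i
  let wr : ι → ℤ := fun i => if w i < 0 then N + w i else 0
  have hwi0 : ¬ w i0 < 0 := by omega
  have hwl : ∀ i, |wl i| ≤ N := by
    intro i; simp only [wl]; split_ifs
    · simp
    · exact hw i
  have hwr : ∀ i, 0 ≤ wr i ∧ wr i < N := by
    intro i; have := abs_le.1 (hw i); simp only [wr]; split_ifs <;> omega
  obtain ⟨l, e', M', hM1, hM2⟩ := IH (Sum.elim F e) (Sum.elim wl wr) (by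
      rintro (i | i)
      · exact hwl i
      · have := hwr i; simp only [Sum.elim_inr]; rw [abs_le]; omega) (by
      have hsub : (Finset.univ.filter fun i => |Sum.elim wl wr i| = (N : ℤ)) ⊆
          ((Finset.univ.filter fun i => |w i| = (N : ℤ)).erase i0).image Sum.inl := by
        rintro (i | i) hi
        · simp only [Finset.mem_filter, Finset.mem_univ, true_and, Sum.elim_inl, wl] at hi
          have : i ≠ i0 := by
            rintro rfl
            simp at hi; omega
          simp only [this, if_false] at hi
          simp [this, hi]
        · simp only [Finset.mem_filter, Finset.mem_univ, true_and, Sum.elim_inr] at hi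
          have := hwr i
          rw [abs_of_nonneg this.1] at hi
          omega
      refine lt_of_le_of_lt (Finset.card_le_card hsub) (lt_of_le_of_lt Finset.card_image_le ?_)
      apply Finset.card_erase_lt_of_mem
      simp [hi0]) (by
      apply G.canc (a := ∑ i, (-w i).toNat • e i)
      simp only [Fintype.sum_sum_type, Sum.elim_inl, Sum.elim_inr]
      have hr0 : ∀ i, (- wr i).toNat • e i = 0 := by
        intro i; have := hwr i; rw [Int.toNat_of_nonpos (by omega), zero_nsmul]
      rw [Finset.sum_congr rfl (fun i _ => hr0 i), Finset.sum_const_zero, add_zero,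
        ← Finset.sum_add_distrib, ← Finset.sum_add_distrib, ← Finset.sum_add_distrib]
      have hR : ∑ i, ((-w i).toNat • e i + (-wl i).toNat • F i) = ∑ i, (-w i).toNat • d i := by
        apply Finset.sum_congr rfl
        intro i _
        by_cases h : w i < 0
        · have : i ≠ i0 := by rintro rfl; omega
          simp only [wl, F, this, if_false, h, if_true]
          rw [hf1 i h, nsmul_add]
        · have h1 : (- w i).toNat = 0 := Int.toNat_of_nonpos (by omega)
          have h2 : (- wl i).toNat = 0 := by
            apply Int.toNat_of_nonpos; simp only [wl]; split_ifs <;> omega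
          rw [h1, h2]; simp
      rw [hR, ← heq, ← Finset.add_sum_erase _ (fun i => (w i).toNat • d i) (Finset.mem_univ i0)]
      simp only [hi0, Int.toNat_natCast]
      have : ∑ i ∈ Finset.univ.erase i0, (w i).toNat • d i =
          ∑ i, (if i = i0 then 0 else (w i).toNat • d i) := by
        rw [← Finset.add_sum_erase Finset.univ (fun i => if i = i0 then 0 else (w i).toNat • d i)
          (Finset.mem_univ i0), if_pos rfl, zero_add]
        apply Finset.sum_congr rfl
        intro i hi
        rw [if_neg (Finset.ne_of_mem_erase hi)]
      rw [this]
      have hL : ∀ i, (-w i).toNat • e i + ((wl i).toNat • F i + (wr i).toNat • e i) =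
          N • e i + (if i = i0 then 0 else (w i).toNat • d i) := by
        intro i
        by_cases h : w i < 0
        · have hii : i ≠ i0 := by rintro rfl; omega
          have := abs_le.1 (hw i)
          simp only [wl, wr, F, hii, if_false, h, if_true]
          rw [Int.toNat_of_nonpos h.le, zero_nsmul, zero_nsmul, zero_add, add_zero, ← add_nsmul]
          congr 1; omega
        · rw [hf2 i h]
          by_cases hii : i = i0
          · simp [wl, F, hii]
          · simp [wl, F, hii, h]
      rw [Finset.sum_congr rfl (fun i _ => hL i), Finset.sum_add_distrib,
        ← Finset.smul_sum, ← he])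
  refine ⟨l, e', fun i j => if i = i0 then ∑ i', (if w i' < 0 then M' (Sum.inr i') j else 0)
    else M' (Sum.inl i) j + (if w i < 0 then M' (Sum.inr i) j else 0), ?_, ?_⟩
  · intro i
    by_cases hii : i = i0
    · subst hii
      simp only [if_true]
      rw [he]
      simp_rw [Finset.sum_smul]
      rw [Finset.sum_comm]
      apply Finset.sum_congr rfl
      intro i' _
      by_cases h : w i' < 0
      · simpa [h] using hM1 (Sum.inr i')
      · simp [h, hf2 i' h]
    · simp only [hii, if_false]
      have h1 := hM1 (Sum.inl i)
      have h2 := hM1 (Sum.inr i)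
      simp only [Sum.elim_inl, Sum.elim_inr, F, hii, if_false] at h1 h2
      by_cases h : w i < 0
      · simp only [h, if_true] at h1 ⊢
        simp_rw [add_nsmul]
        rw [Finset.sum_add_distrib, ← h1, ← h2, hf1 i h, add_comm]
      · simpa [h] using h1
  · intro j
    have := hM2 j
    simp only [Fintype.sum_sum_type, Sum.elim_inl, Sum.elim_inr] at this
    refine Eq.trans ?_ this
    rw [← Finset.add_sum_erase _ _ (Finset.mem_univ i0)]
    beta_reduce
    rw [if_pos rfl, hi0]
    rw [← Finset.add_sum_erase _ (fun i => wl i * (M' (Sum.inl i) j : ℤ)) (Finset.mem_univ i0)]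
    have h1 : wl i0 = 0 := by simp [wl]
    have h3 : ∑ i, wr i * (M' (Sum.inr i) j : ℤ) =
        ∑ i, (N : ℤ) * (if w i < 0 then (M' (Sum.inr i) j : ℤ) else 0) +
        ∑ i, (w i) * (if w i < 0 then (M' (Sum.inr i) j : ℤ) else 0) := by
      rw [← Finset.sum_add_distrib]
      apply Finset.sum_congr rfl
      intro i _
      simp only [wr]
      split_ifs <;> ring
    have h4 : ∑ i, (w i) * (if w i < 0 then (M' (Sum.inr i) j : ℤ) else 0) =
        ∑ i ∈ Finset.univ.erase i0, (w i) * (if w i < 0 then (M' (Sum.inr i) j : ℤ) else 0) := by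
      rw [← Finset.add_sum_erase _ _ (Finset.mem_univ i0), if_neg hwi0, mul_zero, zero_add]
    rw [h1, h3, h4, zero_mul, zero_add, add_left_comm, ← Finset.sum_add_distrib, ← Finset.mul_sum]
    push_cast
    congr 1
    apply Finset.sum_congr rfl
    intro i hi
    simp only [Finset.ne_of_mem_erase hi, if_false, wl]
    push_cast
    ring

theorem GoodMon.shenZ (G : GoodMon T) (N : ℕ) : ∀ (cnt : ℕ) (ι : Type v) [Fintype ι]
    (d : ι → T) (w : ι → ℤ), (∀ i, |w i| ≤ N) →
      (Finset.univ.filter fun i => |w i| = N).card ≤ cnt →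
      (∑ i, (w i).toNat • d i = ∑ i, (-w i).toNat • d i) → ShenC d w := by
  classical
  induction N with
  | zero =>
    intro cnt ι _ d w hw _ _
    have hw0 : ∀ i, w i = 0 := fun i => by have := hw i; simpa using this
    refine ⟨Fintype.card ι, fun j => d ((Fintype.equivFin ι).symm j),
      fun i j => if j = Fintype.equivFin ι i then 1 else 0, ?_, ?_⟩
    · intro i
      simp [ite_smul]
    · intro j; simp [hw0]
  | succ N IHN =>
    intro cnt
    induction cnt with
    | zero =>
      intro ι _ d w hw hc heq
      refine IHN (Fintype.card ι) ι d w ?_ (Finset.card_le_univ _) heq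
      intro i
      have h1 := hw i
      have h2 : i ∉ (Finset.univ.filter fun i => |w i| = ((N + 1 : ℕ) : ℤ)) := by
        rw [Finset.card_eq_zero.1 (Nat.le_zero.1 hc)]; simp
      simp only [Finset.mem_filter, Finset.mem_univ, true_and] at h2
      push_cast at h1 h2
      omega
    | succ cnt IH =>
      intro ι _ d w hw hc heq
      by_cases hex : ∃ i0, |w i0| = ((N + 1 : ℕ) : ℤ)
      · obtain ⟨i0, hi0⟩ := hex
        rcases (abs_eq (by positivity)).1 hi0 with h | h
        · apply G.shen_step (N + 1) (by omega) d w hw i0 h heq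
          intro d' w' h1 h2 h3
          exact IH (ι ⊕ ι) d' w' h1 (by omega) h3
        · have : ShenC d (fun i => - w i) := by
            apply G.shen_step (N + 1) (by omega) d _ (by simpa using hw) i0
              (by simp only [h]; ring) (by simpa using heq.symm)
            intro d' w' h1 h2 h3
            simp only [abs_neg] at h2
            exact IH (ι ⊕ ι) d' w' h1 (by omega) h3
          obtain ⟨l, e, M, hM, hM'⟩ := this
          refine ⟨l, e, M, hM, fun j => ?_⟩
          have := hM' j
          simp only [neg_mul, Finset.sum_neg_distrib, neg_eq_zero] at this
          exact this
      · push Not at hex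
        refine IH ι d w hw ?_ heq
        rw [Finset.filter_false_of_mem (by simpa using hex)]
        simp

theorem GoodMon.shen (G : GoodMon T) {ι : Type v} [Fintype ι] (d : ι → T) (a b : ι → ℕ)
    (h : ∑ i, a i • d i = ∑ i, b i • d i) :
    ∃ (l : ℕ) (e : Fin l → T) (M : ι → Fin l → ℕ),
      (∀ i, d i = ∑ j, M i j • e j) ∧ ∀ j, ∑ i, a i * M i j = ∑ i, b i * M i j := by
  have hb : ∃ N : ℕ, ∀ i, |(a i : ℤ) - b i| ≤ N := by
    refine ⟨∑ i, (a i + b i), fun i => ?_⟩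
    have : a i + b i ≤ ∑ i, (a i + b i) :=
      Finset.single_le_sum (f := fun i => a i + b i) (fun _ _ => Nat.zero_le _) (Finset.mem_univ i)
    rw [abs_le]
    omega
  obtain ⟨N, hN⟩ := hb
  have : ShenC d (fun i => (a i : ℤ) - b i) := by
    refine G.shenZ N _ ι d _ hN le_rfl ?_
    apply G.canc (a := ∑ i, (min (a i) (b i)) • d i)
    rw [← Finset.sum_add_distrib, ← Finset.sum_add_distrib]
    simp_rw [← add_nsmul]
    convert h using 2 <;> congr 1 <;> omega
  obtain ⟨l, e, M, h1, h2⟩ := this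
  refine ⟨l, e, M, h1, fun j => ?_⟩
  have := h2 j
  simp only [sub_mul, Finset.sum_sub_distrib] at this
  zify
  linarith

end AbstractMonoid


section Concrete

open Topology

variable {Γ : Type*} [Group Γ] {X : Type*} [TopologicalSpace X]

theorem alpha_mul (α : Γ →* X ≃ₜ X) (γ δ : Γ) (x : X) : α (γ * δ) x = α γ (α δ x) := by
  rw [map_mul]; rfl

theorem alpha_one (α : Γ →* X ≃ₜ X) (x : X) : α 1 x = x := by
  rw [map_one]; rfl

theorem alpha_inv_apply (α : Γ →* X ≃ₜ X) (γ : Γ) (x : X) : α γ⁻¹ (α γ x) = x := by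
  rw [← alpha_mul, inv_mul_cancel, alpha_one]

theorem alpha_apply_inv (α : Γ →* X ≃ₜ X) (γ : Γ) (x : X) : α γ (α γ⁻¹ x) = x := by
  rw [← alpha_mul, mul_inv_cancel, alpha_one]

theorem homeo_mul_apply (g h : X ≃ₜ X) (x : X) : (g * h) x = g (h x) := rfl
theorem homeo_one_apply (x : X) : (1 : X ≃ₜ X) x = x := rfl
theorem homeo_inv_apply_self (g : X ≃ₜ X) (x : X) : g⁻¹ (g x) = x := g.symm_apply_apply x
theorem homeo_apply_inv_self (g : X ≃ₜ X) (x : X) : g (g⁻¹ x) = x := g.apply_symm_apply x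

theorem actC_apply (α : Γ →* X ≃ₜ X) (γ : Γ) (f : C(X, ℕ)) (x : X) :
    actC α γ f x = f (α γ⁻¹ x) := rfl

theorem actC_add (α : Γ →* X ≃ₜ X) (γ : Γ) (f g : C(X, ℕ)) :
    actC α γ (f + g) = actC α γ f + actC α γ g := rfl

theorem actC_actC (α : Γ →* X ≃ₜ X) (γ δ : Γ) (f : C(X, ℕ)) :
    actC α γ (actC α δ f) = actC α (γ * δ) f := by
  ext x; simp only [actC_apply, mul_inv_rev, alpha_mul]

theorem actC_one (α : Γ →* X ≃ₜ X) (f : C(X, ℕ)) : actC α 1 f = f := by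
  ext x; simp only [actC_apply, inv_one, alpha_one]

/-- Pointwise combination of two functions. -/
def mkC (φ : ℕ → ℕ → ℕ) (f g : C(X, ℕ)) : C(X, ℕ) :=
  ⟨fun x => φ (f x) (g x),
    (continuous_of_discreteTopology (f := fun p : ℕ × ℕ => φ p.1 p.2)).comp
      (f.continuous.prodMk g.continuous)⟩

theorem mkC_apply (φ : ℕ → ℕ → ℕ) (f g : C(X, ℕ)) (x : X) : mkC φ f g x = φ (f x) (g x) := rfl

theorem C_refine (a b c d : C(X, ℕ)) (h : a + b = c + d) :
    ∃ p q r s : C(X, ℕ), a = p + q ∧ b = r + s ∧ c = p + r ∧ d = q + s := by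
  have h' : ∀ x, a x + b x = c x + d x := fun x => by
    simpa using DFunLike.congr_fun h x
  refine ⟨mkC min a c, mkC (fun a c => a - c) a c, mkC (fun a c => c - a) a c,
    mkC (fun b r => b - r) b (mkC (fun a c => c - a) a c), ?_, ?_, ?_, ?_⟩ <;>
  · ext x
    have := h' x
    simp only [ContinuousMap.add_apply, mkC_apply]
    omega

theorem C_conical (a b : C(X, ℕ)) (h : a + b = 0) : a = 0 := by
  ext x
  have : a x + b x = 0 := by simpa using DFunLike.congr_fun h x
  simp only [ContinuousMap.zero_apply]; omega

theorem C_le (a b : C(X, ℕ)) (h : ∀ x, a x ≤ b x) : ∃ c, a + c = b := by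
  refine ⟨mkC (fun b a => b - a) b a, ?_⟩
  ext x
  have := h x
  simp only [ContinuousMap.add_apply, mkC_apply]
  omega

theorem C_bdd [CompactSpace X] (f : C(X, ℕ)) : ∃ N, ∀ x, f x ≤ N := by
  have : (Set.range f).Finite := (isCompact_range f.continuous).finite_of_discrete
  obtain ⟨N, hN⟩ := this.bddAbove
  exact ⟨N, fun x => hN ⟨x, rfl⟩⟩

section TR
variable (α : Γ →* X ≃ₜ X)

theorem TypeRel.of_fintype {ι : Type*} [Fintype ι] (h : ι → C(X, ℕ)) (γ : ι → Γ) :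
    TypeRel α (∑ i, h i) (∑ i, actC α (γ i) (h i)) := by
  let e := Fintype.equivFin ι
  refine ⟨Fintype.card ι, fun j => h (e.symm j), fun j => γ (e.symm j), ?_, ?_⟩
  · exact (Equiv.sum_comp e.symm _).symm
  · exact (Equiv.sum_comp e.symm (fun i => actC α (γ i) (h i))).symm

theorem typeRel_single (γ : Γ) (f : C(X, ℕ)) : TypeRel α f (actC α γ f) := by
  simpa using TypeRel.of_fintype α (fun _ : Unit => f) (fun _ => γ)

theorem typeRel_refl (f : C(X, ℕ)) : TypeRel α f f := by
  simpa [actC_one] using typeRel_single α 1 f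

variable {α}

theorem TypeRel.symm' {f g : C(X, ℕ)} (h : TypeRel α f g) : TypeRel α g f := by
  obtain ⟨n, k, γ, rfl, rfl⟩ := h
  have := TypeRel.of_fintype α (fun i => actC α (γ i) (k i)) (fun i => (γ i)⁻¹)
  simpa [actC_actC, actC_one] using this

theorem TypeRel.add' {f g f' g' : C(X, ℕ)} (h : TypeRel α f g) (h' : TypeRel α f' g') :
    TypeRel α (f + f') (g + g') := by
  obtain ⟨n, k, γ, rfl, rfl⟩ := h
  obtain ⟨n', k', γ', rfl, rfl⟩ := h'
  simpa using TypeRel.of_fintype α (Sum.elim k k') (Sum.elim γ γ')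

theorem TypeRel.sum' {ι : Type*} (s : Finset ι) {f g : ι → C(X, ℕ)}
    (h : ∀ i ∈ s, TypeRel α (f i) (g i)) : TypeRel α (∑ i ∈ s, f i) (∑ i ∈ s, g i) := by
  classical
  induction s using Finset.induction_on with
  | empty => simpa using typeRel_refl α 0
  | insert a s ha ih =>
    rw [Finset.sum_insert ha, Finset.sum_insert ha]
    exact (h a (by simp)).add' (ih fun i hi => h i (by simp [hi]))

theorem actC_sum {ι : Type*} (s : Finset ι) (γ : Γ) (f : ι → C(X, ℕ)) :
    actC α γ (∑ i ∈ s, f i) = ∑ i ∈ s, actC α γ (f i) := by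
  ext x; simp [actC_apply]

theorem TypeRel.act {f g : C(X, ℕ)} (h : TypeRel α f g) (δ : Γ) : TypeRel α f (actC α δ g) := by
  obtain ⟨n, k, γ, rfl, rfl⟩ := h
  have := TypeRel.of_fintype α k (fun i => δ * γ i)
  simpa [actC_sum, actC_actC] using this

theorem TypeRel.split {f g1 g2 : C(X, ℕ)} (h : TypeRel α f (g1 + g2)) :
    ∃ f1 f2, f = f1 + f2 ∧ TypeRel α f1 g1 ∧ TypeRel α f2 g2 := by
  obtain ⟨n, k, γ, rfl, h2⟩ := h
  obtain ⟨u, v, hu, hv, huv⟩ := riesz_gen C_refine C_conical Finset.univ _ _ _ h2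
  refine ⟨∑ i, actC α (γ i)⁻¹ (u i), ∑ i, actC α (γ i)⁻¹ (v i), ?_, ?_, ?_⟩
  · rw [← Finset.sum_add_distrib]
    apply Finset.sum_congr rfl
    intro i hi
    rw [← actC_add, ← huv i hi, actC_actC, inv_mul_cancel, actC_one]
  · rw [hu]
    exact (TypeRel.of_fintype α u (fun i => (γ i)⁻¹)).symm'
  · rw [hv]
    exact (TypeRel.of_fintype α v (fun i => (γ i)⁻¹)).symm'

theorem TypeRel.split_sum {ι : Type*} (s : Finset ι) (g : ι → C(X, ℕ)) :
    ∀ {f : C(X, ℕ)}, TypeRel α f (∑ i ∈ s, g i) →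
    ∃ f' : ι → C(X, ℕ), f = ∑ i ∈ s, f' i ∧ ∀ i ∈ s, TypeRel α (f' i) (g i) := by
  classical
  induction s using Finset.induction_on with
  | empty =>
    intro f h
    obtain ⟨n, k, γ, hf, h2⟩ := h
    refine ⟨fun _ => 0, ?_, by simp⟩
    have hk : ∀ i, actC α (γ i) (k i) = 0 := by
      intro i
      apply C_conical _ (∑ j ∈ Finset.univ.erase i, actC α (γ j) (k j))
      rw [Finset.add_sum_erase _ (fun j => actC α (γ j) (k j)) (Finset.mem_univ i), ← h2, Finset.sum_empty]
    have hk' : ∀ i, k i = 0 := by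
      intro i
      have := congrArg (actC α (γ i)⁻¹) (hk i)
      rw [actC_actC, inv_mul_cancel, actC_one] at this
      rw [this]; rfl
    rw [hf]; simp [hk']
  | insert a s ha ih =>
    intro f h
    rw [Finset.sum_insert ha] at h
    obtain ⟨f1, f2, rfl, h1, h2⟩ := h.split
    obtain ⟨f', rfl, hf'⟩ := ih h2
    refine ⟨Function.update f' a f1, ?_, ?_⟩
    · rw [Finset.sum_insert ha, Function.update_self]
      congr 1
      apply Finset.sum_congr rfl
      intro j hj
      rw [Function.update_of_ne]
      rintro rfl; exact ha hj
    · intro j hj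
      by_cases hja : j = a
      · subst hja; simpa using h1
      · rw [Function.update_of_ne hja]
        exact hf' j (Finset.mem_of_mem_insert_of_ne hj hja)

theorem TypeRel.trans' {f g e : C(X, ℕ)} (h : TypeRel α f g) (h' : TypeRel α g e) :
    TypeRel α f e := by
  obtain ⟨n, k, γ, rfl, rfl⟩ := h'
  obtain ⟨f', rfl, hf'⟩ := TypeRel.split_sum _ _ h
  exact TypeRel.sum' _ fun i hi => (hf' i hi).act (γ i)

variable (α) in
/-- `TypeRel` as a congruence. -/
def trCon : AddCon C(X, ℕ) where
  r := TypeRel α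
  iseqv := ⟨typeRel_refl α, TypeRel.symm', TypeRel.trans'⟩
  add' := TypeRel.add'

theorem typeCon_iff {f g : C(X, ℕ)} : typeCon α f g ↔ TypeRel α f g := by
  constructor
  · intro h
    have : typeCon α ≤ trCon α := AddCon.addConGen_le.2 (fun _ _ h => h)
    exact this h
  · intro h
    exact AddConGen.Rel.of _ _ h

theorem cls_eq {f g : C(X, ℕ)} : cls α f = cls α g ↔ TypeRel α f g := by
  rw [← typeCon_iff]; exact AddCon.eq _

variable (α) in
theorem cls_add (f g : C(X, ℕ)) : cls α (f + g) = cls α f + cls α g := rfl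
variable (α) in
theorem cls_zero : cls α 0 = 0 := rfl
variable (α) in
theorem cls_surj (t : TypeSemigroup α) : ∃ f, cls α f = t := by
  induction t using AddCon.induction_on with
  | H f => exact ⟨f, rfl⟩
variable (α) in
/-- `cls` as a hom. -/
def clsHom : C(X, ℕ) →+ TypeSemigroup α where
  toFun := cls α
  map_zero' := rfl
  map_add' _ _ := rfl

variable (α) in
theorem cls_sum {ι : Type*} (s : Finset ι) (f : ι → C(X, ℕ)) :
    cls α (∑ i ∈ s, f i) = ∑ i ∈ s, cls α (f i) := map_sum (clsHom α) f s
variable (α) in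
theorem cls_nsmul (n : ℕ) (f : C(X, ℕ)) : cls α (n • f) = n • cls α f :=
  map_nsmul (clsHom α) n f

theorem T_refine (a b c d : TypeSemigroup α) (h : a + b = c + d) :
    ∃ p q r s, a = p + q ∧ b = r + s ∧ c = p + r ∧ d = q + s := by
  obtain ⟨a, rfl⟩ := cls_surj α a
  obtain ⟨b, rfl⟩ := cls_surj α b
  obtain ⟨c, rfl⟩ := cls_surj α c
  obtain ⟨d, rfl⟩ := cls_surj α d
  rw [← cls_add, ← cls_add, cls_eq] at h
  obtain ⟨c', d', h1, h2, h3⟩ := h.split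
  obtain ⟨p, q, r, s, e1, e2, e3, e4⟩ := C_refine _ _ _ _ h1
  refine ⟨cls α p, cls α q, cls α r, cls α s, ?_, ?_, ?_, ?_⟩
  · rw [e1, cls_add]
  · rw [e2, cls_add]
  · rw [← cls_add, ← e3]; exact (cls_eq.2 h2).symm
  · rw [← cls_add, ← e4]; exact (cls_eq.2 h3).symm

theorem cls_eq_zero {f : C(X, ℕ)} (h : cls α f = 0) : f = 0 := by
  rw [← cls_zero, cls_eq] at h
  have h0 : (0 : C(X, ℕ)) = ∑ i ∈ (∅ : Finset ℕ), (fun _ => 0 : ℕ → C(X, ℕ)) i := by simp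
  rw [h0] at h
  obtain ⟨f', hf, -⟩ := TypeRel.split_sum _ _ h
  simpa using hf

theorem cls_actC (γ : Γ) (f : C(X, ℕ)) : cls α (actC α γ f) = cls α f :=
  (cls_eq.2 (typeRel_single α γ f)).symm

end TR

end Concrete


section Concrete3

open Topology

variable {Γ : Type*} [Group Γ] {X : Type*} [TopologicalSpace X]

theorem exists_state [CompactSpace X] (hamen : ∃ m : Set Γ → ℝ, IsInvFapm m)
    (α : Γ →* X ≃ₜ X) (x0 : X) : ∃ Lf : C(X, ℕ) → ℝ,
      (∀ f g, Lf (f + g) = Lf f + Lf g) ∧ (∀ f, 0 ≤ Lf f) ∧ Lf 1 = 1 ∧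
      ∀ γ f, Lf (actC α γ f) = Lf f := by
  obtain ⟨m, m0, m1, mu, madd, minv⟩ := hamen
  letI : MeasurableSpace Γ := ⊤
  have hfin : ∀ f : C(X, ℕ), (Set.range fun γ : Γ => (f (α γ x0) : ℝ)).Finite := by
    intro f
    have : (Set.range f).Finite := (isCompact_range f.continuous).finite_of_discrete
    apply (this.image (fun n : ℕ => (n : ℝ))).subset
    rintro _ ⟨γ, rfl⟩
    exact ⟨_, ⟨_, rfl⟩, rfl⟩
  let sf : C(X, ℕ) → SimpleFunc Γ ℝ := fun f =>
    ⟨fun γ => (f (α γ x0) : ℝ), fun _ => trivial, hfin f⟩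
  have hsf : ∀ f γ, sf f γ = (f (α γ x0) : ℝ) := fun _ _ => rfl
  let Tm : Set Γ → ℝ →L[ℝ] ℝ := fun s => m s • ContinuousLinearMap.id ℝ ℝ
  have hadd : FinMeasAdditive (0 : Measure Γ) Tm := by
    intro s t _ _ _ _ hst
    simp only [Tm, madd s t hst, add_smul]
  refine ⟨fun f => (sf f).setToSimpleFunc Tm, ?_, ?_, ?_, ?_⟩
  · intro f g
    have : sf (f + g) = sf f + sf g := by
      ext γ
      rw [SimpleFunc.coe_add, Pi.add_apply, hsf, hsf, hsf, ContinuousMap.add_apply, Nat.cast_add]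
    simp only [this]
    exact SimpleFunc.setToSimpleFunc_add Tm hadd (by simp) (by simp)
  · intro f
    apply SimpleFunc.setToSimpleFunc_nonneg
    · intro s x hx
      simp only [Tm]
      exact mul_nonneg (m0 s) hx
    · intro γ
      exact Nat.cast_nonneg _
  · have : sf 1 = SimpleFunc.const Γ 1 := by
      ext γ
      rw [hsf]; simp
    have hne : Nonempty Γ := ⟨1⟩
    have hpre : (SimpleFunc.const Γ (1 : ℝ)) ⁻¹' {1} = Set.univ := by
      ext γ; simp
    simp only [this, SimpleFunc.setToSimpleFunc]
    rw [SimpleFunc.range_const, Finset.sum_singleton, hpre]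
    simp only [Tm, mu]
    simp
  · intro γ f
    have hpre : ∀ r : ℝ, (sf (actC α γ f)) ⁻¹' {r} = (γ * ·) '' ((sf f) ⁻¹' {r}) := by
      intro r
      ext δ
      simp only [Set.mem_preimage, Set.mem_singleton_iff, Set.mem_image, hsf,
        actC_apply, ← alpha_mul]
      constructor
      · intro h; exact ⟨γ⁻¹ * δ, h, by group⟩
      · rintro ⟨ε, h, rfl⟩; simpa using h
    have hr : (sf (actC α γ f)).range = (sf f).range := by
      ext r
      simp only [SimpleFunc.mem_range, Set.mem_range, hsf, actC_apply,
        ← alpha_mul]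
      constructor
      · rintro ⟨δ, h⟩; exact ⟨γ⁻¹ * δ, h⟩
      · rintro ⟨δ, h⟩; exact ⟨γ * δ, by simpa using h⟩
    simp only [SimpleFunc.setToSimpleFunc]
    rw [hr]
    apply Finset.sum_congr rfl
    intro r _
    rw [hpre]
    simp only [Tm, minv]

theorem cover_of_ne_zero [CompactSpace X] {α : Γ →* X ≃ₜ X} (hmin : IsMinimalAction α)
    {f : C(X, ℕ)} (hf : f ≠ 0) : ∃ s : Finset Γ, ∀ x, 1 ≤ ∑ γ ∈ s, actC α γ⁻¹ f x := by
  have hop : ∀ γ : Γ, IsOpen {x | f (α γ x) ≠ 0} := fun γ =>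
    (isOpen_discrete {n : ℕ | n ≠ 0}).preimage (f.continuous.comp (α γ).continuous)
  have hF : IsClosed (⋃ γ : Γ, {x | f (α γ x) ≠ 0})ᶜ := (isOpen_iUnion hop).isClosed_compl
  have hcov : (⋃ γ : Γ, {x | f (α γ x) ≠ 0}) = Set.univ := by
    rcases hmin _ hF (by
      rintro γ _ ⟨x, hx, rfl⟩
      simp only [Set.mem_compl_iff, Set.mem_iUnion, Set.mem_ofPred_eq, not_exists, not_not] at hx ⊢
      intro δ
      rw [← alpha_mul]; exact hx _) with h | h
    · exact Set.compl_empty_iff.1 h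
    · exfalso
      apply hf
      ext x
      have : x ∈ (⋃ γ : Γ, {x | f (α γ x) ≠ 0})ᶜ := by rw [h]; trivial
      simp only [Set.mem_compl_iff, Set.mem_iUnion, Set.mem_ofPred_eq, not_exists, not_not] at this
      simpa [alpha_one] using this 1
  obtain ⟨s, hs⟩ := isCompact_univ.elim_finite_subcover _ hop hcov.ge
  refine ⟨s, fun x => ?_⟩
  have := hs (Set.mem_univ x)
  simp only [Set.mem_iUnion, Set.mem_ofPred_eq] at this
  obtain ⟨γ, hγ, hx⟩ := this
  have h1 : 1 ≤ actC α γ⁻¹ f x := by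
    rw [actC_apply, inv_inv]; omega
  exact h1.trans (Finset.single_le_sum (f := fun γ => actC α γ⁻¹ f x)
    (fun _ _ => Nat.zero_le _) hγ)

theorem C_sum_apply {ι : Type*} (s : Finset ι) (f : ι → C(X, ℕ)) (x : X) :
    (∑ i ∈ s, f i) x = ∑ i ∈ s, f i x := by simp

theorem goodMon [CompactSpace X] (hamen : ∃ m : Set Γ → ℝ, IsInvFapm m)
    {α : Γ →* X ≃ₜ X} (hmin : IsMinimalAction α) (hun : IsUnperforated α) :
    GoodMon (TypeSemigroup α) where
  refine' := T_refine
  simple := by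
    intro a b hb
    obtain ⟨f, rfl⟩ := cls_surj α a
    obtain ⟨g, rfl⟩ := cls_surj α b
    have hg : g ≠ 0 := by rintro rfl; exact hb rfl
    obtain ⟨s, hs⟩ := cover_of_ne_zero hmin hg
    obtain ⟨N, hN⟩ := C_bdd f
    obtain ⟨c, hc⟩ := C_le f (N • ∑ γ ∈ s, actC α γ⁻¹ g) (by
      intro x
      rw [ContinuousMap.smul_apply, C_sum_apply, smul_eq_mul]
      have := hs x
      have := hN x
      nlinarith)
    refine ⟨N * s.card, cls α c, ?_⟩
    rw [← cls_add, hc, cls_nsmul, cls_sum]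
    simp only [cls_actC, Finset.sum_const]
    rw [mul_nsmul']
  fin := by
    intro b c k h
    obtain ⟨f, rfl⟩ := cls_surj α b
    obtain ⟨g, rfl⟩ := cls_surj α c
    by_contra hf0
    have hf : f ≠ 0 := by rintro rfl; exact hf0 rfl
    have hx : ∃ x, f x ≠ 0 := by
      by_contra hx; push Not at hx; exact hf (by ext x; simpa using hx x)
    obtain ⟨x0, -⟩ := hx
    obtain ⟨L, hadd, hnn, h1, hinv⟩ := exists_state hamen α x0
    have h0 : L 0 = 0 := by have := hadd 0 0; rw [add_zero] at this; linarith
    have hsmul : ∀ (n : ℕ) (f : C(X, ℕ)), L (n • f) = n • L f := fun n f =>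
      map_nsmul (⟨⟨L, h0⟩, hadd⟩ : C(X, ℕ) →+ ℝ) n f
    rw [← cls_nsmul, ← cls_nsmul, ← cls_add, cls_eq] at h
    have hL : ∀ f g : C(X, ℕ), TypeRel α f g → L f = L g := by
      rintro f g ⟨n, k, γ, rfl, rfl⟩
      let L' : C(X, ℕ) →+ ℝ := ⟨⟨L, h0⟩, hadd⟩
      have e1 : L (∑ i, k i) = ∑ i, L (k i) := map_sum L' k _
      have e2 : L (∑ i, actC α (γ i) (k i)) = ∑ i, L (actC α (γ i) (k i)) :=
        map_sum L' (fun i => actC α (γ i) (k i)) _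
      rw [e1, e2]; simp only [hinv]
    have := hL _ _ h
    rw [hadd, hsmul, hsmul, succ_nsmul] at this
    have hLf : L f = 0 := by
      have := hnn f; have := hnn g; linarith
    obtain ⟨s, hs⟩ := cover_of_ne_zero hmin hf
    obtain ⟨c, hc⟩ := C_le 1 (∑ γ ∈ s, actC α γ⁻¹ f) (by
      intro x; rw [C_sum_apply]; exact hs x)
    have e := congrArg L hc
    rw [hadd, h1] at e
    have e2 : L (∑ γ ∈ s, actC α γ⁻¹ f) = ∑ γ ∈ s, L (actC α γ⁻¹ f) :=
      map_sum (⟨⟨L, h0⟩, hadd⟩ : C(X, ℕ) →+ ℝ) (fun γ => actC α γ⁻¹ f) s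
    rw [e2] at e
    simp only [hinv, hLf, Finset.sum_const_zero] at e
    have := hnn c
    linarith
  unperf := hun

/-- `chi A` is the indicator function of `A`, for clopen `A`. -/
noncomputable def chi (A : Set X) : C(X, ℕ) :=
  open Classical in
  if h : IsClopen A then
    ⟨fun x => if x ∈ A then 1 else 0, Continuous.if (by
      intro a ha
      have : frontier A = ∅ := h.frontier_eq
      exact absurd ha (by change a ∉ frontier A; rw [this]; simp)) continuous_const continuous_const⟩
  else 0

theorem chi_apply {A : Set X} (h : IsClopen A) (x : X) [Decidable (x ∈ A)] :
    chi A x = if x ∈ A then 1 else 0 := by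
  unfold chi
  rw [dif_pos h, ContinuousMap.coe_mk]
  split_ifs <;> rfl

theorem chi_eq_one {A : Set X} (h : IsClopen A) (x : X) : chi A x = 1 ↔ x ∈ A := by
  classical
  rw [chi_apply h]; split_ifs with hx <;> simp [hx]

theorem chi_eq_zero {A : Set X} (h : IsClopen A) (x : X) : chi A x = 0 ↔ x ∉ A := by
  classical
  rw [chi_apply h]; split_ifs with hx <;> simp [hx]

theorem chi_add_compl {A : Set X} (h : IsClopen A) : chi A + chi Aᶜ = 1 := by
  classical
  ext x
  rw [ContinuousMap.add_apply, chi_apply h, chi_apply h.compl]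
  by_cases hx : x ∈ A <;> simp [hx]

/-- Index maps with clopen fibers. -/
def CF {ι : Type*} (π : X → ι) : Prop := ∀ i, IsClopen (π ⁻¹' {i})

theorem CF.ev {ι : Type*} {π : X → ι} (h : CF π) (x : X) : ∀ᶠ y in 𝓝 x, π y = π x :=
  (h (π x)).isOpen.mem_nhds (by simp)

theorem CF_of_ev {ι : Type*} {π : X → ι} (h : ∀ x, ∀ᶠ y in 𝓝 x, π y = π x) : CF π := by
  have h' : IsLocallyConstant π := (IsLocallyConstant.iff_eventually_eq π).2 h
  intro i
  exact h'.isClopen_fiber i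

theorem CF_fin {ι : Type*} [Finite ι] {π : X → ι} (h : ∀ i, IsOpen (π ⁻¹' {i})) : CF π := by
  apply CF_of_ev
  intro x
  exact (h (π x)).mem_nhds (by simp)

theorem sum_chi {ι : Type*} [Fintype ι] {π : X → ι} (h : CF π) : ∑ i, chi (π ⁻¹' {i}) = 1 := by
  classical
  ext x
  rw [C_sum_apply]
  simp [chi_apply (h _)]

theorem exists_index {ι : Type*} [Fintype ι] (h : ι → C(X, ℕ)) (hs : ∑ i, h i = 1) :
    ∃ π : X → ι, CF π ∧ ∀ i, h i = chi (π ⁻¹' {i}) := by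
  classical
  have key : ∀ x, ∃ i, h i x = 1 ∧ ∀ j, j ≠ i → h j x = 0 := by
    intro x
    have h1 : ∑ i, h i x = 1 := by rw [← C_sum_apply, hs]; rfl
    have h2 : ∃ i, h i x ≠ 0 := by
      by_contra hc; push Not at hc; simp [hc] at h1
    obtain ⟨i, hi⟩ := h2
    rw [← Finset.add_sum_erase _ _ (Finset.mem_univ i)] at h1
    refine ⟨i, by omega, fun j hj => ?_⟩
    have h3 : ∑ j ∈ Finset.univ.erase i, h j x = 0 := by omega
    exact (Finset.sum_eq_zero_iff.1 h3) j (by simp [hj])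
  choose π hπ1 hπ2 using key
  have hfib : ∀ i, π ⁻¹' {i} = (h i) ⁻¹' {1} := by
    intro i; ext x
    simp only [Set.mem_preimage, Set.mem_singleton_iff]
    constructor
    · rintro rfl; exact hπ1 x
    · intro hx; by_contra hne
      have := hπ2 x i (Ne.symm hne); omega
  have hCF : CF π := fun i => by
    rw [hfib]; exact (isClopen_discrete _).preimage (h i).continuous
  refine ⟨π, hCF, fun i => ?_⟩
  ext x
  rw [chi_apply (hCF i)]
  split_ifs with hx
  · rw [hfib] at hx; exact hx
  · exact hπ2 x i (fun h => hx (by simp [h]))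

/-- Gluing homeomorphisms along clopen partitions. -/
theorem glue {ι : Type*} (π₁ π₂ : X → ι) (h₁ : CF π₁) (h₂ : CF π₂) (h : ι → X ≃ₜ X)
    (H : ∀ i x, π₁ x = i ↔ π₂ (h i x) = i) :
    ∃ g : X ≃ₜ X, (∀ x, g x = h (π₁ x) x) ∧ ∀ x, π₂ (g x) = π₁ x := by
  have e1 : ∀ x, π₂ (h (π₁ x) x) = π₁ x := fun x => (H _ x).1 rfl
  have e2 : ∀ y, π₁ ((h (π₂ y)).symm y) = π₂ y := fun y => (H _ _).2 (by simp)
  refine ⟨⟨⟨fun x => h (π₁ x) x, fun y => (h (π₂ y)).symm y, ?_, ?_⟩, ?_, ?_⟩, fun _ => rfl, e1⟩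
  · intro x; simp only [e1, Homeomorph.symm_apply_apply]
  · intro y; simp only [e2, Homeomorph.apply_symm_apply]
  · change Continuous fun x => h (π₁ x) x
    rw [continuous_iff_continuousAt]
    intro x
    apply (h (π₁ x)).continuous.continuousAt.congr
    filter_upwards [h₁.ev x] with y hy
    rw [hy]
  · change Continuous fun y => (h (π₂ y)).symm y
    rw [continuous_iff_continuousAt]
    intro x
    apply (h (π₂ x)).symm.continuous.continuousAt.congr
    filter_upwards [h₂.ev x] with y hy
    rw [hy]

end Concrete3



section TFG

open Topology

variable {Γ : Type*} [Group Γ] {X : Type*} [TopologicalSpace X] {α : Γ →* X ≃ₜ X}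

/-- Local version of the membership in the topological full group. -/
def LocTFG (α : Γ →* X ≃ₜ X) (g : X ≃ₜ X) : Prop := ∀ x, ∃ γ, ∀ᶠ y in 𝓝 x, g y = α γ y

theorem InTopFullGroup.loc {g : X ≃ₜ X} (h : InTopFullGroup α g) : LocTFG α g := by
  obtain ⟨n, P, γ, hP, -, hU, hg⟩ := h
  intro x
  have : x ∈ ⋃ i, P i := by rw [hU]; trivial
  obtain ⟨i, hi⟩ := Set.mem_iUnion.1 this
  exact ⟨γ i, Filter.mem_of_superset ((hP i).isOpen.mem_nhds hi) (hg i)⟩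

theorem LocTFG.tfg [CompactSpace X] [T2Space X] [TotallyDisconnectedSpace X] {g : X ≃ₜ X}
    (h : LocTFG α g) : InTopFullGroup α g := by
  classical
  have h1 : ∀ x, ∃ γ, ∃ V : Set X, IsClopen V ∧ x ∈ V ∧ ∀ y ∈ V, g y = α γ y := by
    intro x
    obtain ⟨γ, hγ⟩ := h x
    obtain ⟨U, hU, hUo, hxU⟩ := mem_nhds_iff.1 hγ
    obtain ⟨V, hV, hxV, hVU⟩ := compact_exists_isClopen_in_isOpen hUo hxU
    exact ⟨γ, V, hV, hxV, fun y hy => hU (hVU hy)⟩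
  choose γ V hV hxV hg using h1
  obtain ⟨s, hs⟩ := isCompact_univ.elim_finite_subcover V (fun x => (hV x).isOpen)
    (fun x _ => Set.mem_iUnion.2 ⟨x, hxV x⟩)
  let e := s.equivFin
  let W : Fin s.card → Set X := fun i => V (e.symm i)
  refine ⟨s.card, fun i => W i \ ⋃ j : {j // j < i}, W j, fun i => γ (e.symm i), ?_, ?_, ?_, ?_⟩
  · intro i
    exact (hV _).diff (isClopen_iUnion_of_finite fun j => hV _)
  · intro i j hij
    rw [Set.disjoint_left]
    rintro x ⟨hxi, hni⟩ ⟨hxj, hnj⟩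
    rcases lt_or_gt_of_ne hij with hl | hl
    · exact hnj (Set.mem_iUnion.2 ⟨⟨i, hl⟩, hxi⟩)
    · exact hni (Set.mem_iUnion.2 ⟨⟨j, hl⟩, hxj⟩)
  · ext x
    simp only [Set.mem_univ, iff_true]
    have hx := hs (Set.mem_univ x)
    simp only [Set.mem_iUnion] at hx
    obtain ⟨y, hy, hxy⟩ := hx
    have hne : (Finset.univ.filter fun i => x ∈ W i).Nonempty :=
      ⟨e ⟨y, hy⟩, by simp [W, hxy]⟩
    refine Set.mem_iUnion.2 ⟨(Finset.univ.filter fun i => x ∈ W i).min' hne, ?_, ?_⟩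
    · exact (Finset.mem_filter.1 (Finset.min'_mem _ hne)).2
    · rw [Set.mem_iUnion]
      rintro ⟨⟨j, hj⟩, hxj⟩
      exact absurd (Finset.min'_le _ j (by simp [hxj])) (not_le.2 hj)
  · intro i x hx
    exact hg _ _ hx.1

theorem LocTFG.mul {g h : X ≃ₜ X} (hg : LocTFG α g) (hh : LocTFG α h) : LocTFG α (g * h) := by
  intro x
  obtain ⟨γ, hγ⟩ := hh x
  obtain ⟨δ, hδ⟩ := hg (h x)
  refine ⟨δ * γ, ?_⟩
  filter_upwards [hγ, h.continuous.continuousAt.eventually hδ] with y h1 h2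
  rw [homeo_mul_apply, h2, h1, alpha_mul]

theorem LocTFG.inv {g : X ≃ₜ X} (hg : LocTFG α g) : LocTFG α g⁻¹ := by
  intro x
  obtain ⟨γ, hγ⟩ := hg (g⁻¹ x)
  refine ⟨γ⁻¹, ?_⟩
  filter_upwards [(g⁻¹).continuous.continuousAt.eventually hγ] with y h1
  rw [homeo_apply_inv_self] at h1
  conv_rhs => rw [h1]
  rw [alpha_inv_apply]

theorem LocTFG.one : LocTFG α (1 : X ≃ₜ X) := fun x =>
  ⟨1, Filter.Eventually.of_forall fun y => by rw [alpha_one]; rfl⟩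

theorem LocTFG.alpha (γ : Γ) : LocTFG α (α γ) := fun _ => ⟨γ, Filter.Eventually.of_forall fun _ => rfl⟩

theorem LocTFG.glue {ι : Type*} {π : X → ι} (hπ : CF π) {h : ι → X ≃ₜ X} (hh : ∀ i, LocTFG α (h i))
    {g : X ≃ₜ X} (hg : ∀ x, g x = h (π x) x) : LocTFG α g := by
  intro x
  obtain ⟨γ, hγ⟩ := hh (π x) x
  refine ⟨γ, ?_⟩
  filter_upwards [hγ, hπ.ev x] with y h1 h2
  rw [hg, h2, h1]

/-- Composition with the inverse of a homeomorphism. -/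
def pushC (g : X ≃ₜ X) (f : C(X, ℕ)) : C(X, ℕ) := f.comp (g⁻¹ : X ≃ₜ X)

theorem pushC_apply (g : X ≃ₜ X) (f : C(X, ℕ)) (x : X) : pushC g f x = f (g⁻¹ x) := rfl

variable [CompactSpace X] [T2Space X] [TotallyDisconnectedSpace X]

theorem LocTFG.cls {g : X ≃ₜ X} (hg : LocTFG α g) (f : C(X, ℕ)) :
    cls α (pushC g f) = cls α f := by
  classical
  obtain ⟨n, P, γ, hP, hd, hU, hgP⟩ := hg.tfg
  symm
  rw [cls_eq]
  refine ⟨n, fun i => f * chi (P i), γ, ?_, ?_⟩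
  · ext x
    have : x ∈ ⋃ i, P i := by rw [hU]; trivial
    obtain ⟨i, hi⟩ := Set.mem_iUnion.1 this
    rw [C_sum_apply, Finset.sum_eq_single i]
    · rw [ContinuousMap.mul_apply, (chi_eq_one (hP i) x).2 hi, mul_one]
    · intro j _ hj
      rw [ContinuousMap.mul_apply, (chi_eq_zero (hP j) x).2, mul_zero]
      exact fun hxj => Set.disjoint_left.1 (hd hj) hxj hi
    · simp
  · ext y
    obtain ⟨x, rfl⟩ : ∃ x, g x = y := ⟨g⁻¹ y, homeo_apply_inv_self g y⟩
    have : x ∈ ⋃ i, P i := by rw [hU]; trivial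
    obtain ⟨i, hi⟩ := Set.mem_iUnion.1 this
    rw [C_sum_apply, Finset.sum_eq_single i, pushC_apply, homeo_inv_apply_self]
    · rw [actC_apply, hgP i x hi, alpha_inv_apply, ContinuousMap.mul_apply,
        (chi_eq_one (hP i) x).2 hi, mul_one]
    · intro j _ hj
      rw [actC_apply, ContinuousMap.mul_apply, (chi_eq_zero (hP j) _).2, mul_zero]
      intro hxj
      have h1 := hgP j _ hxj
      rw [alpha_apply_inv] at h1
      have h2 := g.injective h1
      rw [h2] at hxj
      exact Set.disjoint_left.1 (hd hj) hxj hi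
    · simp

end TFG

section Easy

open Topology

variable {Γ : Type*} [Group Γ] {X : Type*} [TopologicalSpace X] {α : Γ →* X ≃ₜ X}
  [CompactSpace X]

/-- Averaging relation over large finite subgroups. -/
def AvRel (Λ : Subgroup (X ≃ₜ X)) (f g : C(X, ℕ)) : Prop :=
  ∃ s : Finset (X ≃ₜ X), (s : Set (X ≃ₜ X)) ⊆ Λ ∧ ∀ F : Finset (X ≃ₜ X), s ⊆ F →
    (∀ a ∈ F, ∀ b ∈ F, a * b ∈ F) → (∀ a ∈ F, a⁻¹ ∈ F) →
    ∀ x, ∑ u ∈ F, f (u x) = ∑ u ∈ F, g (u x)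

theorem AvRel.add {Λ : Subgroup (X ≃ₜ X)} {f g f' g' : C(X, ℕ)} (h : AvRel Λ f g)
    (h' : AvRel Λ f' g') : AvRel Λ (f + f') (g + g') := by
  classical
  obtain ⟨s, hs, H⟩ := h
  obtain ⟨s', hs', H'⟩ := h'
  refine ⟨s ∪ s', by simp [hs, hs'], fun F hF hm hi x => ?_⟩
  simp only [ContinuousMap.add_apply, Finset.sum_add_distrib]
  rw [H F (Finset.union_subset_left hF) hm hi, H' F (Finset.union_subset_right hF) hm hi]

theorem AvRel.refl (Λ : Subgroup (X ≃ₜ X)) (f : C(X, ℕ)) : AvRel Λ f f :=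
  ⟨∅, by simp, fun _ _ _ _ _ => rfl⟩

theorem AvRel.sum {Λ : Subgroup (X ≃ₜ X)} {ι : Type*} (t : Finset ι) {f g : ι → C(X, ℕ)}
    (h : ∀ i, AvRel Λ (f i) (g i)) : AvRel Λ (∑ i ∈ t, f i) (∑ i ∈ t, g i) := by
  classical
  induction t using Finset.induction_on with
  | empty => simpa using AvRel.refl Λ 0
  | insert a t ha ih => rw [Finset.sum_insert ha, Finset.sum_insert ha]; exact (h a).add ih

theorem greedy (L : List (X ≃ₜ X)) : ∀ f g : C(X, ℕ), ∃ (m : Fin L.length → C(X, ℕ))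
    (f' g' : C(X, ℕ)), f = f' + ∑ j, m j ∧ g = g' + ∑ j, pushC L[j] (m j) ∧
      ∀ x, ∀ u ∈ L, f' x = 0 ∨ g' (u x) = 0 := by
  induction L with
  | nil => intro f g; exact ⟨fun _ => 0, f, g, by simp, by simp, by simp⟩
  | cons u L ih =>
    intro f g
    let m0 : C(X, ℕ) := mkC min f (g.comp (u : C(X, X)))
    have hm0 : ∀ x, m0 x = min (f x) (g (u x)) := fun x => rfl
    obtain ⟨f1, hf1⟩ := C_le m0 f (fun x => by rw [hm0]; exact min_le_left _ _)
    obtain ⟨g1, hg1⟩ := C_le (pushC u m0) g (fun x => by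
      rw [pushC_apply, hm0, homeo_apply_inv_self]; exact min_le_right _ _)
    obtain ⟨m, f', g', h1, h2, h3⟩ := ih f1 g1
    refine ⟨Fin.cons m0 m, f', g', ?_, ?_, ?_⟩
    · rw [← hf1, h1]
      change _ = f' + ∑ j : Fin (L.length + 1), _
      rw [Fin.sum_univ_succ]
      simp only [Fin.cons_zero, Fin.cons_succ]
      abel
    · rw [← hg1, h2]
      change _ = g' + ∑ j : Fin (L.length + 1), _
      rw [Fin.sum_univ_succ]
      simp only [Fin.cons_zero, Fin.cons_succ]
      simp only [Fin.getElem_fin, Fin.val_zero, Fin.val_succ, List.getElem_cons_zero, List.getElem_cons_succ]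
      abel
    · intro x v hv
      rcases List.mem_cons.1 hv with rfl | hv
      · have e1 : f x = m0 x + (f' x + (∑ j, m j) x) := by
          rw [← hf1, h1]; rfl
        have e2 : g (v x) = m0 x + (g' (v x) + (∑ j, pushC L[j] (m j)) (v x)) := by
          rw [← hg1, h2]
          simp only [ContinuousMap.add_apply, pushC_apply, homeo_inv_apply_self]
        have e3 := hm0 x
        omega
      · exact h3 x v hv

theorem easy_dir [T2Space X] [TotallyDisconnectedSpace X] (h : HasDenseLocallyFiniteSubgroup α) :
    IsUnperforated α := by
  classical
  obtain ⟨Λ, hΛ, hlf, hdense⟩ := h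
  have act : ∀ γ f, AvRel Λ f (actC α γ f) := by
    intro γ f
    obtain ⟨N, hN⟩ := C_bdd f
    obtain ⟨l, hl, hlP⟩ := hdense (α γ) (LocTFG.alpha γ).tfg (N + 1) (fun i => f ⁻¹' {(i : ℕ)})
      (fun i => (isClopen_discrete _).preimage f.continuous)
      (fun i j hij => by
        refine Set.disjoint_left.2 ?_
        intro x hx hy
        simp only [Set.mem_preimage, Set.mem_singleton_iff] at hx hy
        exact hij (Fin.ext (hx.symm.trans hy)))
      (by
        ext x
        simp only [Set.mem_iUnion, Set.mem_preimage, Set.mem_singleton_iff, Set.mem_univ, iff_true]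
        exact ⟨⟨f x, Nat.lt_succ_of_le (hN x)⟩, rfl⟩)
    have hfl : ∀ y, f (α γ⁻¹ y) = f (l⁻¹ y) := by
      intro y
      have h1 : y ∈ ⇑(l) '' (f ⁻¹' {f (l⁻¹ y)}) := ⟨l⁻¹ y, rfl, homeo_apply_inv_self _ _⟩
      rw [hlP ⟨f (l⁻¹ y), Nat.lt_succ_of_le (hN _)⟩] at h1
      obtain ⟨z, hz, rfl⟩ := h1
      rw [alpha_inv_apply]; exact hz
    refine ⟨{l}, by simpa using hl, fun F hF hm hi x => ?_⟩
    have hlF : l ∈ F := hF (by simp)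
    refine Finset.sum_bij' (fun u _ => l * u) (fun u _ => l⁻¹ * u) ?_ ?_ ?_ ?_ ?_
    · intro u hu; exact hm _ hlF _ hu
    · intro u hu; exact hm _ (hi _ hlF) _ hu
    · intro u hu; group
    · intro u hu; group
    · intro u hu
      rw [actC_apply, hfl, homeo_mul_apply, homeo_inv_apply_self]
  intro a b n hn hle
  obtain ⟨f, rfl⟩ := cls_surj α a
  obtain ⟨g, rfl⟩ := cls_surj α b
  obtain ⟨c, hc⟩ := hle
  obtain ⟨k, rfl⟩ := cls_surj α c
  rw [← cls_nsmul, ← cls_nsmul, ← cls_add, cls_eq] at hc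
  obtain ⟨N, p, γ, h1, h2⟩ := hc
  have hav : AvRel Λ (n • f + k) (n • g) := by
    rw [h1, h2]; exact AvRel.sum _ fun i => act _ _
  obtain ⟨s, hs, H⟩ := hav
  have hfin := hlf s hs
  let F : Finset (X ≃ₜ X) := hfin.toFinset
  have hF : ∀ u, u ∈ F ↔ u ∈ Subgroup.closure (s : Set (X ≃ₜ X)) := fun u => by
    simp [F]
  have hFΛ : ∀ u ∈ F, u ∈ Λ := fun u hu => (Subgroup.closure_le Λ).2 hs ((hF u).1 hu)
  have hav := H F (fun u hu => (hF u).2 (Subgroup.subset_closure hu))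
    (fun a ha b hb => (hF _).2 (mul_mem ((hF _).1 ha) ((hF _).1 hb)))
    (fun a ha => (hF _).2 (inv_mem ((hF _).1 ha)))
  have hle : ∀ x, ∑ u ∈ F, f (u x) ≤ ∑ u ∈ F, g (u x) := by
    intro x
    have := hav x
    simp only [ContinuousMap.add_apply, ContinuousMap.smul_apply, Finset.sum_add_distrib,
      smul_eq_mul, ← Finset.mul_sum] at this
    exact Nat.le_of_mul_le_mul_left (by omega) hn
  obtain ⟨m, f', g', e1, e2, e3⟩ := greedy F.toList f g
  have hL : ∀ j : Fin F.toList.length, F.toList[j] ∈ F := fun j =>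
    Finset.mem_toList.1 (List.getElem_mem _)
  have hsum : ∀ x (v : X ≃ₜ X), v ∈ F → ∀ p : C(X, ℕ),
      ∑ u ∈ F, pushC v p (u x) = ∑ u ∈ F, p (u x) := by
    intro x v hv p
    refine Finset.sum_bij' (fun u _ => v⁻¹ * u) (fun u _ => v * u) ?_ ?_ ?_ ?_ ?_
    · intro u hu; exact (hF _).2 (mul_mem (inv_mem ((hF _).1 hv)) ((hF _).1 hu))
    · intro u hu; exact (hF _).2 (mul_mem ((hF _).1 hv) ((hF _).1 hu))
    · intro u hu; group
    · intro u hu; group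
    · intro u hu; rfl
  have hf' : f' = 0 := by
    ext x
    by_contra hx
    have hx' : f' x ≠ 0 := hx
    have hg' : ∀ u ∈ F, g' (u x) = 0 := fun u hu =>
      (e3 x u (Finset.mem_toList.2 hu)).resolve_left hx'
    have h3 := hle x
    rw [e1, e2] at h3
    simp only [ContinuousMap.add_apply, C_sum_apply, Finset.sum_add_distrib] at h3
    rw [Finset.sum_eq_zero hg'] at h3
    rw [Finset.sum_comm (s := F), Finset.sum_comm (s := F)] at h3
    simp only [hsum x _ (hL _)] at h3
    have h4 : f' ((1 : X ≃ₜ X) x) ≤ ∑ u ∈ F, f' (u x) :=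
      Finset.single_le_sum (f := fun u : X ≃ₜ X => f' (u x)) (fun _ _ => Nat.zero_le _)
        ((hF 1).2 (one_mem _))
    rw [homeo_one_apply] at h4
    omega
  refine ⟨cls α g', ?_⟩
  rw [e1, e2, hf', zero_add, cls_add, cls_sum, cls_sum, add_comm]
  congr 1
  apply Finset.sum_congr rfl
  intro j _
  exact (LocTFG.cls (hΛ (hFΛ _ (hL j))).loc _).symm

end Easy



section Hard

open Topology

variable {Γ : Type*} [Group Γ] {X : Type*} [TopologicalSpace X] {α : Γ →* X ≃ₜ X}

variable (α) in
/-- Class of a clopen set. -/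
noncomputable def KK (A : Set X) : TypeSemigroup α := cls α (chi A)

theorem KK_eq_zero {A : Set X} (hA : IsClopen A) (h : KK α A = 0) (x : X) : x ∉ A := by
  have := cls_eq_zero h
  rw [← chi_eq_zero hA, this]; rfl

theorem KK_empty : KK α (∅ : Set X) = 0 := by
  have : chi (∅ : Set X) = 0 := by
    ext x; rw [(chi_eq_zero isClopen_empty x).2 (by simp)]; rfl
  rw [KK, this, cls_zero]

theorem KK_image [CompactSpace X] [T2Space X] [TotallyDisconnectedSpace X] {g : X ≃ₜ X}
    (hg : LocTFG α g) {A B : Set X} (hA : IsClopen A) (hB : IsClopen B)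
    (h : ∀ x, x ∈ A ↔ g x ∈ B) : KK α A = KK α B := by
  classical
  have : chi B = pushC g (chi A) := by
    ext x
    rw [pushC_apply, chi_apply hA, chi_apply hB]
    have := h (g⁻¹ x)
    rw [homeo_apply_inv_self] at this
    simp only [this]
  rw [KK, KK, this, hg.cls]

theorem split_piece {A : Set X} (hA : IsClopen A) {κ : Type*} [Fintype κ]
    (e : κ → TypeSemigroup α) (h : KK α A = ∑ k, e k) :
    ∃ ρ : X → Option κ, CF ρ ∧ (∀ x, ρ x = none ↔ x ∉ A) ∧ ∀ k, KK α (ρ ⁻¹' {some k}) = e k := by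
  choose f hf using fun k => cls_surj α (e k)
  have h1 : TypeRel α (chi A) (∑ k, f k) := by
    rw [← cls_eq, cls_sum]; simp only [hf]; exact h
  obtain ⟨f', hf', hr⟩ := TypeRel.split_sum _ _ h1
  let u : Option κ → C(X, ℕ) := fun o => o.elim (chi Aᶜ) f'
  have hu : ∑ o, u o = 1 := by
    rw [Fintype.sum_option]
    change chi Aᶜ + ∑ k, f' k = 1
    rw [← hf', add_comm, chi_add_compl hA]
  obtain ⟨ρ, hρ, hui⟩ := exists_index u hu
  refine ⟨ρ, hρ, fun x => ?_, fun k => ?_⟩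
  · have : chi (ρ ⁻¹' {none}) = chi Aᶜ := (hui none).symm
    rw [← Set.mem_compl_iff, ← chi_eq_one hA.compl, ← this, chi_eq_one (hρ _)]; rfl
  · rw [KK, ← hui (some k), ← hf k]
    exact cls_eq.2 (hr k (Finset.mem_univ k))

theorem exists_tfg (G : GoodMon (TypeSemigroup α)) {A B : Set X} (hA : IsClopen A)
    (hB : IsClopen B) (h : KK α A = KK α B) : ∃ g, LocTFG α g ∧ ∀ x, x ∈ A ↔ g x ∈ B := by
  have hc : KK α Aᶜ = KK α Bᶜ := by
    apply G.canc (a := KK α A)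
    conv_rhs => rw [h]
    rw [KK, KK, KK, KK, ← cls_add, ← cls_add, chi_add_compl hA, chi_add_compl hB]
  obtain ⟨n, h1, γ1, eA, eB⟩ := cls_eq.1 h
  obtain ⟨m, h2, γ2, eA', eB'⟩ := cls_eq.1 hc
  let u := Sum.elim h1 h2
  let γ := Sum.elim γ1 γ2
  obtain ⟨π₁, hπ₁, e1⟩ := exists_index u (by
    rw [Fintype.sum_sum_type]
    simp only [u, Sum.elim_inl, Sum.elim_inr]
    rw [← eA, ← eA', chi_add_compl hA])
  obtain ⟨π₂, hπ₂, e2⟩ := exists_index (fun i => actC α (γ i) (u i)) (by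
    rw [Fintype.sum_sum_type]
    simp only [u, γ, Sum.elim_inl, Sum.elim_inr]
    rw [← eB, ← eB', chi_add_compl hB])
  have c1 : ∀ i x, π₁ x = i ↔ u i x = 1 := by
    intro i x
    rw [e1, chi_eq_one (hπ₁ i)]; rfl
  have c2 : ∀ i x, π₂ x = i ↔ actC α (γ i) (u i) x = 1 := by
    intro i x
    have := e2 i
    rw [this, chi_eq_one (hπ₂ i)]; rfl
  obtain ⟨g, hg, hg2⟩ := glue π₁ π₂ hπ₁ hπ₂ (fun i => α (γ i)) (by
    intro i x
    rw [c1, c2, actC_apply, alpha_inv_apply])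
  have key : ∀ {A : Set X} (_ : IsClopen A) {k : ℕ} (h : Fin k → C(X, ℕ)) (_ : chi A = ∑ i, h i)
      (i : Fin k) (x : X), h i x = 1 → x ∈ A := by
    intro A hA k h hs i x hx
    by_contra hn
    have := (chi_eq_zero hA x).2 hn
    rw [hs, C_sum_apply] at this
    have := Finset.sum_eq_zero_iff.1 this i (Finset.mem_univ i)
    omega
  refine ⟨g, LocTFG.glue hπ₁ (fun i => LocTFG.alpha (γ i)) hg, fun x => ?_⟩
  have := hg2 x
  rcases hi : π₁ x with i | i
  · rw [hi] at this
    exact ⟨fun _ => key hB _ eB i _ ((c2 _ _).1 this), fun _ => key hA _ eA i _ ((c1 _ _).1 hi)⟩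
  · rw [hi] at this
    exact ⟨fun hx => absurd hx (key hA.compl _ eA' i _ ((c1 _ _).1 hi)),
      fun hx => absurd hx (key hB.compl _ eB' i _ ((c2 _ _).1 this))⟩

open Classical in
variable (α) in
/-- A chosen clopen representative of a class. -/
noncomputable def rep (t : TypeSemigroup α) : Set X :=
  if h : ∃ A : Set X, IsClopen A ∧ KK α A = t then h.choose else ∅

theorem rep_clopen (t : TypeSemigroup α) : IsClopen (rep α t) := by
  unfold rep
  split_ifs with h
  · exact h.choose_spec.1
  · exact isClopen_empty

theorem KK_rep {A : Set X} (hA : IsClopen A) : KK α (rep α (KK α A)) = KK α A := by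
  have h : ∃ B : Set X, IsClopen B ∧ KK α B = KK α A := ⟨A, hA, rfl⟩
  unfold rep
  rw [dif_pos h]
  exact h.choose_spec.2

theorem exists_q (G : GoodMon (TypeSemigroup α)) {A : Set X} (hA : IsClopen A) :
    ∃ g, LocTFG α g ∧ ∀ x, x ∈ A ↔ g x ∈ rep α (KK α A) :=
  exists_tfg G hA (rep_clopen _) (KK_rep hA).symm

variable (α) in
/-- A finite clopen partition with chosen identifications between pieces of the same class. -/
structure Sys where
  ι : Type
  fin : Finite ι
  π : X → ι
  cf : CF π
  p : ι → X ≃ₜ X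
  tfg : ∀ i, LocTFG α (p i)
  hp : ∀ i x, π x = i ↔ p i x ∈ rep α (KK α (π ⁻¹' {i}))

namespace Sys

/-- Class of an atom. -/
noncomputable def t (S : Sys α) (i : S.ι) : TypeSemigroup α := KK α (S.π ⁻¹' {i})

theorem hp' (S : Sys α) (i : S.ι) (x : X) : S.π x = i ↔ S.p i x ∈ rep α (S.t i) := S.hp i x

theorem t_ne_zero (S : Sys α) (x : X) : S.t (S.π x) ≠ 0 := fun h =>
  KK_eq_zero (S.cf _) h x rfl

/-- The finite group attached to a system. -/
def Lam (S : Sys α) : Subgroup (X ≃ₜ X) where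
  carrier := {g | ∀ x, S.t (S.π (g x)) = S.t (S.π x) ∧ S.p (S.π (g x)) (g x) = S.p (S.π x) x ∧
    ∀ y, S.π y = S.π x → S.π (g y) = S.π (g x)}
  one_mem' := fun x => ⟨rfl, rfl, fun _ h => h⟩
  mul_mem' := by
    intro a b ha hb x
    obtain ⟨h1, h2, h3⟩ := hb x
    obtain ⟨h1', h2', h3'⟩ := ha (b x)
    exact ⟨h1'.trans h1, h2'.trans h2, fun y hy => h3' _ (h3 y hy)⟩
  inv_mem' := by
    intro g hg y
    obtain ⟨x, rfl⟩ : ∃ x, g x = y := ⟨g⁻¹ y, homeo_apply_inv_self g y⟩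
    obtain ⟨h1, h2, h3⟩ := hg x
    rw [homeo_inv_apply_self]
    refine ⟨h1.symm, h2.symm, fun y' hy' => ?_⟩
    obtain ⟨x', hx'⟩ : ∃ x', S.p (S.π x) x' = S.p (S.π (g x)) y' :=
      ⟨(S.p (S.π x))⁻¹ _, homeo_apply_inv_self _ _⟩
    have hx : S.π x' = S.π x := by
      rw [S.hp', hx', ← h1, ← S.hp']; exact hy'
    have h4 := h3 x' hx
    have h5 := (hg x').2.1
    rw [h4, hx, hx'] at h5
    have h6 : g x' = y' := (S.p _).injective h5
    rw [← h6, homeo_inv_apply_self, hx]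

theorem mem_Lam (S : Sys α) (g : X ≃ₜ X) : g ∈ S.Lam ↔
    ∀ x, S.t (S.π (g x)) = S.t (S.π x) ∧ S.p (S.π (g x)) (g x) = S.p (S.π x) x ∧
    ∀ y, S.π y = S.π x → S.π (g y) = S.π (g x) := Iff.rfl

theorem Lam_finite (S : Sys α) : (S.Lam : Set (X ≃ₜ X)).Finite := by
  have := S.fin
  let φ : S.Lam → (S.ι → Set S.ι) := fun g i => {j | ∃ x, S.π x = i ∧ S.π (g.1 x) = j}
  have hφ : Function.Injective φ := by
    intro g g' h
    apply Subtype.ext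
    apply Homeomorph.ext
    intro x
    have h1 : S.π (g.1 x) ∈ φ g (S.π x) := ⟨x, rfl, rfl⟩
    rw [h] at h1
    obtain ⟨y, hy, hy2⟩ := h1
    have h2 := (g'.2 x).2.2 y hy
    have h3 := (g.2 x).2.1
    have h4 := (g'.2 x).2.1
    rw [← h2, hy2, ← h3] at h4
    exact ((S.p _).injective h4).symm
  exact @Set.toFinite _ _ (Finite.of_injective φ hφ)

theorem Lam_tfg (S : Sys α) {g : X ≃ₜ X} (hg : g ∈ S.Lam) : LocTFG α g := by
  refine LocTFG.glue (π := fun x => (S.π x, S.π (g x))) ?_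
    (h := fun ij => (S.p ij.2)⁻¹ * S.p ij.1) (fun ij => (S.tfg _).inv.mul (S.tfg _)) ?_
  · apply CF_of_ev
    intro x
    filter_upwards [S.cf.ev x, g.continuous.continuousAt.eventually (S.cf.ev (g x))] with y h1 h2
    rw [h1, h2]
  · intro x
    simp only [homeo_mul_apply]
    rw [← (hg x).2.1, homeo_inv_apply_self]

/-- A set is a union of atoms. -/
def sat (S : Sys α) (A : Set X) : Prop := ∀ x y, S.π x = S.π y → (x ∈ A ↔ y ∈ A)

/-- Refinement order. -/
def le (S S' : Sys α) : Prop := S.Lam ≤ S'.Lam ∧ ∀ A, S.sat A → S'.sat A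

theorem le.refl (S : Sys α) : S.le S := ⟨le_rfl, fun _ h => h⟩
theorem le.trans {S S' S'' : Sys α} (h : S.le S') (h' : S'.le S'') : S.le S'' :=
  ⟨h.1.trans h'.1, fun A hA => h'.2 A (h.2 A hA)⟩

theorem exists_init (G : GoodMon (TypeSemigroup α)) : Nonempty (Sys α) := by
  obtain ⟨q, hq, hq2⟩ := exists_q (α := α) G (isClopen_univ (X := X))
  refine ⟨⟨Unit, inferInstance, fun _ => (), ?_, fun _ => q, fun _ => hq, ?_⟩⟩
  · exact CF_of_ev fun x => Filter.Eventually.of_forall fun _ => rfl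
  · intro i x
    have : (fun _ : X => ()) ⁻¹' {i} = Set.univ := by ext; simp
    rw [this, ← hq2]; simp

theorem exists_ref [CompactSpace X] [T2Space X] [TotallyDisconnectedSpace X]
    (G : GoodMon (TypeSemigroup α)) (S : Sys α) {κ : Type} [Finite κ]
    (ρ : TypeSemigroup α → X → κ) (hρ : ∀ t, CF (ρ t)) :
    ∃ S' : Sys α, ∃ e : S'.ι ≃ S.ι × κ,
      S.le S' ∧ (∀ x, e (S'.π x) = (S.π x, ρ (S.t (S.π x)) (S.p (S.π x) x))) ∧
      ∀ i', S'.t i' = KK α (rep α (S.t (e i').1) ∩ ρ (S.t (e i').1) ⁻¹' {(e i').2}) := by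
  have := S.fin
  have hE : ∀ t k, IsClopen (rep α t ∩ ρ t ⁻¹' {k}) := fun t k => (rep_clopen t).inter (hρ t k)
  choose q hq hq2 using fun t k => exists_q G (hE t k)
  let π' : X → S.ι × κ := fun x => (S.π x, ρ (S.t (S.π x)) (S.p (S.π x) x))
  have hπ' : CF π' := by
    apply CF_of_ev
    intro x
    filter_upwards [S.cf.ev x, (S.p (S.π x)).continuous.continuousAt.eventually
      ((hρ (S.t (S.π x))).ev (S.p (S.π x) x))] with y h1 h2
    simp only [π', h1, h2]
  have hiff : ∀ i k x, π' x = (i, k) ↔ S.p i x ∈ rep α (S.t i) ∩ ρ (S.t i) ⁻¹' {k} := by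
    intro i k x
    simp only [π', Prod.mk.injEq, Set.mem_inter_iff, ← S.hp', Set.mem_preimage,
      Set.mem_singleton_iff]
    constructor
    · rintro ⟨rfl, h⟩; exact ⟨rfl, h⟩
    · rintro ⟨rfl, h⟩; exact ⟨rfl, h⟩
  have hK : ∀ i k, KK α (π' ⁻¹' {(i, k)}) = KK α (rep α (S.t i) ∩ ρ (S.t i) ⁻¹' {k}) := by
    intro i k
    exact KK_image (S.tfg i) (hπ' _) (hE _ _) (fun x => hiff i k x)
  let p' : S.ι × κ → X ≃ₜ X := fun ik => q (S.t ik.1) ik.2 * S.p ik.1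
  let S' : Sys α := ⟨S.ι × κ, inferInstance, π', hπ', p',
    fun ik => (hq _ _).mul (S.tfg _), by
      rintro ⟨i, k⟩ x
      rw [hK, hiff]
      exact hq2 _ _ _⟩
  have ht : ∀ i k, S'.t (i, k) = KK α (rep α (S.t i) ∩ ρ (S.t i) ⁻¹' {k}) := hK
  refine ⟨S', Equiv.refl _, ⟨?_, ?_⟩, fun _ => rfl, fun i' => ht _ _⟩
  · intro g hg x
    obtain ⟨h1, h2, h3⟩ := hg x
    have e1 : ∀ y, S.t (S.π (g y)) = S.t (S.π y) := fun y => (hg y).1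
    have e2 : ∀ y, S.p (S.π (g y)) (g y) = S.p (S.π y) y := fun y => (hg y).2.1
    have e3 : ∀ y, π' (g y) = (S.π (g y), (π' y).2) := by
      intro y; simp only [π', e1, e2]
    refine ⟨?_, ?_, ?_⟩
    · change S'.t (π' (g x)) = S'.t (π' x)
      rw [e3, ht, e1]; exact (ht _ _).symm
    · change p' (π' (g x)) (g x) = p' (π' x) x
      rw [e3]
      simp only [p', homeo_mul_apply, e1, e2]; rfl
    · intro y hy
      change π' (g y) = π' (g x)
      have hy : π' y = π' x := hy
      rw [e3, e3, hy, h3 y (congrArg Prod.fst hy)]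
  · intro A hA x y hxy
    exact hA x y (congrArg Prod.fst (show π' x = π' y from hxy))

theorem exists_sat [CompactSpace X] [T2Space X] [TotallyDisconnectedSpace X]
    (G : GoodMon (TypeSemigroup α)) (S : Sys α) {A : Set X} (hA : IsClopen A) :
    ∃ S' : Sys α, S.le S' ∧ S'.sat A := by
  have := S.fin
  obtain ⟨S', e, hle, hπ, -⟩ := S.exists_ref G (κ := Set S.ι)
    (fun _ y => {i | (S.p i)⁻¹ y ∈ A}) (by
      intro _
      apply CF_of_ev
      intro y
      have : ∀ i, ∀ᶠ z in 𝓝 y, ((S.p i)⁻¹ z ∈ A ↔ (S.p i)⁻¹ y ∈ A) := by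
        intro i
        by_cases h : (S.p i)⁻¹ y ∈ A
        · filter_upwards [((S.p i)⁻¹).continuous.continuousAt.eventually (hA.isOpen.mem_nhds h)]
            with z hz
          exact iff_of_true hz h
        · filter_upwards [((S.p i)⁻¹).continuous.continuousAt.eventually
            (hA.compl.isOpen.mem_nhds h)] with z hz
          exact iff_of_false hz h
      filter_upwards [Filter.eventually_all.2 this] with z hz
      ext i; exact hz i)
  refine ⟨S', hle, fun x y hxy => ?_⟩
  have h := hπ x
  rw [hxy, hπ y] at h
  obtain ⟨h1, h2⟩ := Prod.mk.inj h
  have h3 := Set.ext_iff.1 h2 (S.π x)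
  change (S.p (S.π x))⁻¹ _ ∈ A ↔ (S.p (S.π x))⁻¹ _ ∈ A at h3
  rw [homeo_inv_apply_self, h1, homeo_inv_apply_self] at h3
  exact h3.symm

end Sys

open Classical in
theorem exists_perm {ι T : Type*} [Fintype ι] (t : ι → T) (U V : ι → Prop)
    (h : ∀ τ, (Finset.univ.filter fun i => U i ∧ t i = τ).card =
      (Finset.univ.filter fun i => V i ∧ t i = τ).card) :
    ∃ σ : Equiv.Perm ι, (∀ i, t (σ i) = t i) ∧ ∀ i, U i ↔ V (σ i) := by
  let φ : ι → T × Prop := fun i => (t i, U i)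
  let ψ : ι → T × Prop := fun i => (t i, V i)
  have hc : ∀ c, Fintype.card {i // φ i = c} = Fintype.card {i // ψ i = c} := by
    rintro ⟨τ, b⟩
    rw [Fintype.card_subtype, Fintype.card_subtype]
    have hsplit : ∀ W : ι → Prop, (Finset.univ.filter fun i => t i = τ).card =
        (Finset.univ.filter fun i => W i ∧ t i = τ).card +
        (Finset.univ.filter fun i => ¬ W i ∧ t i = τ).card := by
      intro W
      rw [← Finset.card_filter_add_card_filter_not (s := Finset.univ.filter fun i => t i = τ) W,
        Finset.filter_filter, Finset.filter_filter]
      simp only [and_comm]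
    have hT := h τ
    have h1 := hsplit U
    have h2 := hsplit V
    by_cases hb : b
    · have : ∀ W : ι → Prop, (Finset.univ.filter fun i => (t i, W i) = (τ, b)) =
        (Finset.univ.filter fun i => W i ∧ t i = τ) := by
        intro W; ext i; simp [hb, and_comm]
      simp only [φ, ψ, this]
      exact hT
    · have : ∀ W : ι → Prop, (Finset.univ.filter fun i => (t i, W i) = (τ, b)) =
        (Finset.univ.filter fun i => ¬ W i ∧ t i = τ) := by
        intro W; ext i; simp [hb, and_comm]
      simp only [φ, ψ, this]
      omega
  let e := fun c => Fintype.equivOfCardEq (hc c)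
  refine ⟨Equiv.ofFiberEquiv e, fun i => ?_, fun i => ?_⟩
  · exact congrArg Prod.fst (Equiv.ofFiberEquiv_map e i)
  · exact (iff_of_eq (congrArg Prod.snd (Equiv.ofFiberEquiv_map e i))).symm

end Hard



section Hard2

open Topology

variable {Γ : Type*} [Group Γ] {X : Type*} [TopologicalSpace X] {α : Γ →* X ≃ₜ X}

open Classical in
theorem shen_sets {T : Type*} [AddCommMonoid T] (G : GoodMon T) {ι : Type*} [Fintype ι]
    (t : ι → T) (U V : ι → Prop)
    (h : ∑ i with U i, t i = ∑ i with V i, t i) :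
    ∃ (l : ℕ) (e : Fin l → T) (M : ι → Fin l → ℕ), (∀ i, t i = ∑ j, M i j • e j) ∧
      (∀ i i', t i = t i' → M i = M i') ∧
      ∀ j, ∑ i with U i, M i j = ∑ i with V i, M i j := by
  let g : ι → Set.range t := fun i => ⟨t i, i, rfl⟩
  have : Fintype (Set.range t) := Fintype.ofFinite _
  have key : ∀ (W : ι → Prop) {N : Type _} [AddCommMonoid N] (f : Set.range t → N),
      ∑ τ, (Finset.univ.filter fun i => W i ∧ g i = τ).card • f τ = ∑ i with W i, f (g i) := by
    intro W N _ f
    rw [← Finset.sum_fiberwise (Finset.univ.filter fun i => W i) g]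
    apply Finset.sum_congr rfl
    intro τ _
    rw [Finset.filter_filter, ← Finset.sum_const]
    apply Finset.sum_congr rfl
    intro i hi
    rw [(Finset.mem_filter.1 hi).2.2]
  have key2 : ∀ (W : ι → Prop) (f : Set.range t → ℕ),
      ∑ τ, (Finset.univ.filter fun i => W i ∧ g i = τ).card * f τ = ∑ i with W i, f (g i) := by
    intro W f
    rw [← Finset.sum_fiberwise (Finset.univ.filter fun i => W i) g]
    apply Finset.sum_congr rfl
    intro τ _
    rw [Finset.filter_filter, ← smul_eq_mul, ← Finset.sum_const]
    apply Finset.sum_congr rfl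
    intro i hi
    rw [(Finset.mem_filter.1 hi).2.2]
  obtain ⟨l, e, M, h1, h2⟩ := G.shen (fun τ : Set.range t => (τ : T))
    (fun τ => (Finset.univ.filter fun i => U i ∧ g i = τ).card)
    (fun τ => (Finset.univ.filter fun i => V i ∧ g i = τ).card) (by
      rw [key, key]; exact h)
  refine ⟨l, e, fun i => M (g i), fun i => h1 (g i), ?_, ?_⟩
  · intro i i' hi
    have : g i = g i' := Subtype.ext hi
    simp only [this]
  · intro j
    have := h2 j
    rw [key2 U (fun τ => M τ j), key2 V (fun τ => M τ j)] at this
    exact this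

open Classical in
theorem Sys.KK_sat (S : Sys α) [Fintype S.ι] {A : Set X} (hA : IsClopen A) (h : S.sat A) :
    KK α A = ∑ i with (∃ x, S.π x = i ∧ x ∈ A), S.t i := by
  have : chi A = ∑ i with (∃ x, S.π x = i ∧ x ∈ A), chi (S.π ⁻¹' {i}) := by
    ext x
    rw [C_sum_apply]
    simp only [chi_apply (S.cf _), Set.mem_preimage, Set.mem_singleton_iff]
    rw [Finset.sum_ite_eq, chi_apply hA]
    simp only [Finset.mem_filter, Finset.mem_univ, true_and]
    congr 1
    apply propext
    constructor
    · intro hx; exact ⟨x, rfl, hx⟩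
    · rintro ⟨y, hy, hyA⟩; exact (h _ _ hy).1 hyA
  rw [KK, this, cls_sum]; rfl

open Classical in
theorem count_lemma {T : Type*} [AddCommMonoid T] {ι : Type*} [Fintype ι] {l N : ℕ}
    (e : Fin l → T) (M : ι → Fin l → ℕ) (hN : ∀ i j, M i j ≤ N)
    (t' : ι × Option (Fin l × Fin N) → T) (h0 : ∀ i, t' (i, none) = 0)
    (h1 : ∀ i j n, t' (i, some (j, n)) = if (n : ℕ) < M i j then e j else 0)
    (W : ι → Prop) (τ : T) (hτ : τ ≠ 0) :
    (Finset.univ.filter fun x : ι × Option (Fin l × Fin N) => W x.1 ∧ t' x = τ).card =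
      ∑ j, if e j = τ then ∑ i with W i, M i j else 0 := by
  rw [Finset.card_filter, Fintype.sum_prod_type]
  simp only [Fintype.sum_option, Fintype.sum_prod_type, h0, h1, hτ.symm, and_false, if_false,
    zero_add]
  rw [Finset.sum_comm]
  apply Finset.sum_congr rfl
  intro j _
  have hc : ∀ m, m ≤ N → ∑ n : Fin N, (if (n : ℕ) < m then 1 else 0) = m := by
    intro m hm
    rw [Fin.sum_univ_eq_sum_range (fun n => if n < m then 1 else 0) N, ← Finset.card_filter]
    have : (Finset.range N).filter (fun n => n < m) = Finset.range m := by
      ext n; simp; omega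
    rw [this, Finset.card_range]
  have hterm : ∀ i, ∑ n : Fin N, (if W i ∧ (if (n : ℕ) < M i j then e j else 0) = τ then 1 else 0) =
      if e j = τ then (if W i then M i j else 0) else 0 := by
    intro i
    by_cases hW : W i
    · by_cases he : e j = τ
      · simp only [hW, he, true_and, if_true]
        rw [← hc (M i j) (hN i j)]
        apply Finset.sum_congr rfl
        intro n _
        rw [hc (M i j) (hN i j)]
        split_ifs <;> first | rfl | (exfalso; simp_all)
      · simp only [hW, he, true_and, if_false]
        apply Finset.sum_eq_zero
        intro n _
        split_ifs <;> first | rfl | (exfalso; simp_all)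
    · simp [hW]
  simp only [hterm]
  split_ifs with he
  · rw [Finset.sum_filter]
  · simp

theorem Sys.exists_match [CompactSpace X] [T2Space X] [TotallyDisconnectedSpace X]
    (G : GoodMon (TypeSemigroup α)) (S : Sys α) {A B : Set X} (hA : IsClopen A)
    (hB : IsClopen B) (sA : S.sat A) (sB : S.sat B) (h : KK α A = KK α B) :
    ∃ S' : Sys α, S.le S' ∧ ∃ g ∈ S'.Lam, ∀ x, x ∈ A ↔ g x ∈ B := by
  classical
  have := S.fin
  have : Fintype S.ι := Fintype.ofFinite _
  let U : S.ι → Prop := fun i => ∃ x, S.π x = i ∧ x ∈ A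
  let V : S.ι → Prop := fun i => ∃ x, S.π x = i ∧ x ∈ B
  have hU : ∀ x, x ∈ A ↔ U (S.π x) := fun x =>
    ⟨fun hx => ⟨x, rfl, hx⟩, fun ⟨y, hy, hyA⟩ => (sA _ _ hy).1 hyA⟩
  have hV : ∀ x, x ∈ B ↔ V (S.π x) := fun x =>
    ⟨fun hx => ⟨x, rfl, hx⟩, fun ⟨y, hy, hyA⟩ => (sB _ _ hy).1 hyA⟩
  obtain ⟨l, e, M, hM1, hM2, hM3⟩ := shen_sets G S.t U V (by
    have h' := h
    rw [S.KK_sat hA sA, S.KK_sat hB sB] at h'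
    convert h')
  obtain ⟨N, hN⟩ : ∃ N, ∀ i j, M i j ≤ N := by
    refine ⟨∑ i, ∑ j, M i j, fun i j => ?_⟩
    have h1 : M i j ≤ ∑ j, M i j :=
      Finset.single_le_sum (f := fun j => M i j) (fun _ _ => Nat.zero_le _) (Finset.mem_univ j)
    exact h1.trans (Finset.single_le_sum (f := fun i => ∑ j, M i j) (fun _ _ => Nat.zero_le _)
      (Finset.mem_univ i))
  have hcM : ∀ m, m ≤ N → ∀ z : TypeSemigroup α,
      ∑ n : Fin N, (if (n : ℕ) < m then z else 0) = m • z := by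
    intro m hm z
    rw [Fin.sum_univ_eq_sum_range (fun n => if n < m then z else 0) N, ← Finset.sum_filter]
    have : (Finset.range N).filter (fun n => n < m) = Finset.range m := by
      ext n; simp; omega
    rw [this, Finset.sum_const, Finset.card_range]
  have hρ : ∀ τ : TypeSemigroup α, ∃ ρ : X → Option (Fin l × Fin N), CF ρ ∧ ∀ i, S.t i = τ →
      (∀ x, ρ x = none ↔ x ∉ rep α τ) ∧
      ∀ j n, KK α (ρ ⁻¹' {some (j, n)}) = if (n : ℕ) < M i j then e j else 0 := by
    intro τ
    by_cases hτ : ∃ i, S.t i = τ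
    · obtain ⟨i, rfl⟩ := hτ
      obtain ⟨ρ, h1, h2, h3⟩ := split_piece (α := α) (rep_clopen (S.t i))
        (fun jn : Fin l × Fin N => if (jn.2 : ℕ) < M i jn.1 then e jn.1 else 0) (by
          rw [Fintype.sum_prod_type]
          simp only [hcM _ (hN _ _)]
          rw [← hM1]
          exact KK_rep (S.cf i))
      refine ⟨ρ, h1, fun i' hi' => ⟨h2, fun j n => ?_⟩⟩
      rw [h3, hM2 i' i hi']
    · exact ⟨fun _ => none, CF_of_ev fun x => Filter.Eventually.of_forall fun _ => rfl,
        fun i hi => absurd ⟨i, hi⟩ hτ⟩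
  choose ρ hρ1 hρ2 using hρ
  obtain ⟨S', c, hle, hπ, ht⟩ := S.exists_ref G ρ hρ1
  have := S'.fin
  have : Fintype S'.ι := Fintype.ofFinite _
  let t' : S.ι × Option (Fin l × Fin N) → TypeSemigroup α := fun z => S'.t (c.symm z)
  have ht0 : ∀ i, t' (i, none) = 0 := by
    intro i
    simp only [t', ht, Equiv.apply_symm_apply]
    have : rep α (S.t i) ∩ ρ (S.t i) ⁻¹' {none} = ∅ := by
      ext x
      simp only [Set.mem_inter_iff, Set.mem_preimage, Set.mem_singleton_iff,
        (hρ2 _ i rfl).1, Set.mem_empty_iff_false, iff_false]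
      tauto
    rw [this, KK_empty]
  have ht1 : ∀ i j n, t' (i, some (j, n)) = if (n : ℕ) < M i j then e j else 0 := by
    intro i j n
    simp only [t', ht, Equiv.apply_symm_apply]
    have : rep α (S.t i) ∩ ρ (S.t i) ⁻¹' {some (j, n)} = ρ (S.t i) ⁻¹' {some (j, n)} := by
      apply Set.inter_eq_right.2
      intro x hx
      by_contra hn
      rw [← (hρ2 _ i rfl).1] at hn
      simp only [Set.mem_preimage, Set.mem_singleton_iff, hn] at hx
      exact absurd hx (by simp)
    rw [this, (hρ2 _ i rfl).2]
  have hcount : ∀ τ, (Finset.univ.filter fun z : S.ι × Option (Fin l × Fin N) =>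
      (U z.1 ∧ t' z ≠ 0) ∧ t' z = τ).card = (Finset.univ.filter fun z => (V z.1 ∧ t' z ≠ 0) ∧
        t' z = τ).card := by
    intro τ
    by_cases hτ : τ = 0
    · subst hτ
      have : ∀ W : S.ι × Option (Fin l × Fin N) → Prop,
          (Finset.univ.filter fun z => (W z ∧ t' z ≠ 0) ∧ t' z = 0) = ∅ := by
        intro W; ext z; simp
      rw [this (fun z => U z.1), this (fun z => V z.1)]
    · have : ∀ W : S.ι → Prop,
          (Finset.univ.filter fun z : S.ι × Option (Fin l × Fin N) => (W z.1 ∧ t' z ≠ 0) ∧ t' z = τ)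
          = (Finset.univ.filter fun z => W z.1 ∧ t' z = τ) := by
        intro W; ext z
        simp only [Finset.mem_filter, Finset.mem_univ, true_and]
        constructor
        · rintro ⟨⟨h1, _⟩, h2⟩; exact ⟨h1, h2⟩
        · rintro ⟨h1, h2⟩; exact ⟨⟨h1, by rw [h2]; exact hτ⟩, h2⟩
      rw [this U, this V]
      have e1 := count_lemma e M hN t' ht0 ht1 U τ hτ
      have e2 := count_lemma e M hN t' ht0 ht1 V τ hτ
      have e3 : (∑ j, if e j = τ then ∑ i with U i, M i j else 0) =
          ∑ j, if e j = τ then ∑ i with V i, M i j else 0 := by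
        apply Finset.sum_congr rfl
        intro j _
        have := hM3 j
        split_ifs
        · convert this
        · rfl
      convert e1.trans (Eq.trans (by convert e3) e2.symm)
  obtain ⟨σ0, hσ1, hσ2⟩ := exists_perm t' (fun z => U z.1 ∧ t' z ≠ 0) (fun z => V z.1 ∧ t' z ≠ 0)
    (by intro τ; convert hcount τ)
  let σ : Equiv.Perm S'.ι := c.trans (σ0.trans c.symm)
  have hσt : ∀ i, S'.t (σ i) = S'.t i := by
    intro i
    have := hσ1 (c i)
    simp only [t', Equiv.symm_apply_apply] at this
    exact this
  have hσU : ∀ i, S'.t i ≠ 0 → (U (c i).1 ↔ V (c (σ i)).1) := by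
    intro i hi
    have h1 := hσ2 (c i)
    have h2 : t' (c i) ≠ 0 := by simpa [t'] using hi
    have h3 : t' (σ0 (c i)) ≠ 0 := by rw [hσ1]; exact h2
    simp only [h2, h3, ne_eq, not_false_eq_true, and_true] at h1
    rw [h1]
    simp [σ]
  obtain ⟨g, hg1, hg2⟩ := glue S'.π (fun x => σ.symm (S'.π x)) S'.cf
    (by
      apply CF_of_ev
      intro x
      filter_upwards [S'.cf.ev x] with y hy
      rw [hy])
    (fun i => (S'.p (σ i))⁻¹ * S'.p i) (by
      intro i x
      rw [Equiv.symm_apply_eq, S'.hp', S'.hp', hσt, homeo_mul_apply, homeo_apply_inv_self])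
  have hg3 : ∀ x, S'.π (g x) = σ (S'.π x) := fun x => by
    rw [← hg2 x, Equiv.apply_symm_apply]
  refine ⟨S', hle, g, ?_, ?_⟩
  · intro x
    refine ⟨?_, ?_, ?_⟩
    · rw [hg3, hσt]
    · rw [hg3, hg1, homeo_mul_apply, homeo_apply_inv_self]
    · intro y hy; rw [hg3, hg3, hy]
  · intro x
    have h1 := hσU (S'.π x) (S'.t_ne_zero x)
    rw [← hg3, hπ, hπ] at h1
    rw [hU, hV]; exact h1

theorem Sys.exists_step [CompactSpace X] [T2Space X] [TotallyDisconnectedSpace X]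
    (G : GoodMon (TypeSemigroup α)) (S : Sys α) (A B : Set X) :
    ∃ S' : Sys α, S.le S' ∧ (IsClopen A → IsClopen B → KK α A = KK α B →
      S'.sat A ∧ ∃ g ∈ S'.Lam, ∀ x, x ∈ A ↔ g x ∈ B) := by
  by_cases h : IsClopen A ∧ IsClopen B ∧ KK α A = KK α B
  · obtain ⟨hA, hB, hK⟩ := h
    obtain ⟨S1, h1, s1⟩ := S.exists_sat G hA
    obtain ⟨S2, h2, s2⟩ := S1.exists_sat G hB
    obtain ⟨S3, h3, s3⟩ := S2.exists_match G hA hB (h2.2 _ s1) s2 hK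
    exact ⟨S3, (h1.trans h2).trans h3, fun _ _ _ => ⟨h3.2 _ (h2.2 _ s1), s3⟩⟩
  · exact ⟨S, Sys.le.refl S, fun hA hB hK => absurd ⟨hA, hB, hK⟩ h⟩

theorem hard_dir [CompactSpace X] [T2Space X] [TotallyDisconnectedSpace X]
    [SecondCountableTopology X] (G : GoodMon (TypeSemigroup α)) :
    HasDenseLocallyFiniteSubgroup α := by
  have : Countable (TopologicalSpace.Clopens X) :=
    TopologicalSpace.Clopens.countable_iff_secondCountable.2 inferInstance
  obtain ⟨en, hen⟩ := exists_surjective_nat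
    (TopologicalSpace.Clopens X × TopologicalSpace.Clopens X)
  choose nx hnx1 hnx2 using fun (n : ℕ) (S : Sys α) => S.exists_step G (en n).1 (en n).2
  obtain ⟨S0⟩ := Sys.exists_init (α := α) G
  let Q : ℕ → Sys α := fun n => Nat.rec S0 (fun n S => nx n S) n
  have hQ : ∀ n, Q (n + 1) = nx n (Q n) := fun n => rfl
  have hmono : ∀ m n, m ≤ n → (Q m).le (Q n) := by
    intro m n h
    induction n, h using Nat.le_induction with
    | base => exact Sys.le.refl _
    | succ n _ ih => exact ih.trans (by rw [hQ]; exact hnx1 n (Q n))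
  let Λ : Subgroup (X ≃ₜ X) :=
    { carrier := {g | ∃ n, g ∈ (Q n).Lam}
      one_mem' := ⟨0, one_mem _⟩
      mul_mem' := by
        rintro a b ⟨m, hm⟩ ⟨n, hn⟩
        exact ⟨max m n, mul_mem ((hmono m _ (le_max_left _ _)).1 hm)
          ((hmono n _ (le_max_right _ _)).1 hn)⟩
      inv_mem' := by
        rintro a ⟨m, hm⟩
        exact ⟨m, inv_mem hm⟩ }
  have hΛ : ∀ g, g ∈ Λ ↔ ∃ n, g ∈ (Q n).Lam := fun _ => Iff.rfl
  refine ⟨Λ, ?_, ?_, ?_⟩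
  · rintro g ⟨n, hn⟩
    exact ((Q n).Lam_tfg hn).tfg
  · intro s hs
    have : ∃ N, ∀ g ∈ s, g ∈ (Q N).Lam := by
      have h1 : ∀ g : s, ∃ n, g.1 ∈ (Q n).Lam := fun g => hs g.2
      choose n hn using h1
      refine ⟨Finset.univ.sup n, fun g hg => ?_⟩
      exact (hmono _ _ (Finset.le_sup (f := n) (Finset.mem_univ ⟨g, hg⟩))).1 (hn ⟨g, hg⟩)
    obtain ⟨N, hN⟩ := this
    exact (Q N).Lam_finite.subset ((Subgroup.closure_le (Q N).Lam).2 hN)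
  · intro g hg n P hP hd hU
    have hgl := hg.loc
    have hB : ∀ i, IsClopen (g '' P i) := fun i => by
      rw [g.image_eq_preimage_symm]
      exact (hP i).preimage g.symm.continuous
    have hst : ∀ i, ∃ m, (Q m).sat (P i) ∧ ∃ l ∈ (Q m).Lam, ∀ x, x ∈ P i ↔ l x ∈ g '' P i := by
      intro i
      obtain ⟨m, hm⟩ := hen (⟨P i, hP i⟩, ⟨g '' P i, hB i⟩)
      have h2 := hnx2 m (Q m)
      rw [hm] at h2
      exact ⟨m + 1, h2 (hP i) (hB i) (KK_image hgl (hP i) (hB i) fun x =>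
        (g.injective.mem_set_image).symm)⟩
    choose m hsat l hl hl2 using hst
    let N := Finset.univ.sup m
    have hmN : ∀ i, m i ≤ N := fun i => Finset.le_sup (f := m) (Finset.mem_univ i)
    have hsat' : ∀ i, (Q N).sat (P i) := fun i => (hmono _ _ (hmN i)).2 _ (hsat i)
    have hl' : ∀ i, l i ∈ (Q N).Lam := fun i => (hmono _ _ (hmN i)).1 (hl i)
    have hidx : ∀ x, ∃ i, x ∈ P i := fun x => Set.mem_iUnion.1 (by rw [hU]; trivial)
    choose π hπ using hidx
    have hπ2 : ∀ x i, π x = i ↔ x ∈ P i := by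
      intro x i
      constructor
      · rintro rfl; exact hπ x
      · intro hx
        by_contra hne
        exact Set.disjoint_left.1 (hd hne) (hπ x) hx
    have hcf : CF π := by
      intro i
      have : π ⁻¹' {i} = P i := by ext x; exact hπ2 x i
      rw [this]; exact hP i
    have hgm : ∀ i y, y ∈ g '' P i ↔ π (g⁻¹ y) = i := by
      intro i y
      rw [hπ2]
      constructor
      · rintro ⟨x, hx, rfl⟩; rw [homeo_inv_apply_self]; exact hx
      · intro hx; exact ⟨_, hx, homeo_apply_inv_self _ _⟩
    obtain ⟨k, hk1, hk2⟩ := glue π (fun y => π (g⁻¹ y)) hcf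
      (by
        apply CF_of_ev
        intro y
        exact (g⁻¹).continuous.continuousAt.eventually (hcf.ev (g⁻¹ y))) l (by
        intro i x
        rw [← hgm, ← hl2, hπ2])
    refine ⟨k, ⟨N, ?_⟩, fun i => ?_⟩
    · intro x
      rw [hk1]
      obtain ⟨h1, h2, h3⟩ := hl' (π x) x
      refine ⟨h1, h2, fun y hy => ?_⟩
      have : π y = π x := by
        rw [hπ2]; exact (hsat' _ _ _ hy).2 (hπ x)
      rw [hk1, this]; exact h3 y hy
    · ext y
      rw [hgm]
      constructor
      · rintro ⟨x, hx, rfl⟩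
        rw [hk2]; exact (hπ2 _ _).2 hx
      · intro hy
        obtain ⟨x, rfl⟩ : ∃ x, k x = y := ⟨k⁻¹ y, homeo_apply_inv_self k y⟩
        rw [hk2] at hy
        exact ⟨x, (hπ2 _ _).1 hy, rfl⟩

end Hard2


/-- Let `Γ` be a countable amenable group and `α` a minimal action of `Γ`
by homeomorphisms on a compact metrizable `0`-dimensional space `X`. Then `⟦α⟧` admits a
dense locally finite subgroup iff `T(α)` is unperforated. -/
theorem stmt3 {Γ : Type*} [Group Γ] [Countable Γ]
    {X : Type*} [TopologicalSpace X] [CompactSpace X]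
    [TopologicalSpace.MetrizableSpace X] [TotallyDisconnectedSpace X]
    (hamen : ∃ m : Set Γ → ℝ, IsInvFapm m)
    (α : Γ →* (X ≃ₜ X)) (hmin : IsMinimalAction α) :
    HasDenseLocallyFiniteSubgroup α ↔ IsUnperforated α := by
  constructor
  · exact easy_dir
  · intro hun
    have : SecondCountableTopology X := by
      letI := TopologicalSpace.metrizableSpaceMetric X
      infer_instance
    exact hard_dir (goodMon hamen hmin hun)
end

section
/- There exists an action α of ℤ² by homeomorphisms on the Cantor space X = {0,1}^ℕ that is free (α(γ)(x) = x for some x ∈ X implies γ = 0) and minimal (every orbit is dense), and such that the topological full group ⟦α⟧ admits no dense locally finite subgroup. -/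
open MeasureTheory Set
open scoped ENNReal

section Brouwer
variable {X : Type*} [TopologicalSpace X]

def brD (c : ℕ → X → Bool) (m : Set X → ℕ → ℕ) (x : X) : ℕ → Set X
  | 0 => Set.univ
  | n + 1 => brD c m x n ∩ {y | c (m (brD c m x n) n) y = c (m (brD c m x n) n) x}

def brA (c : ℕ → X → Bool) (m : Set X → ℕ → ℕ) (s : ℕ → Bool) : ℕ → Set X
  | 0 => Set.univ
  | n + 1 => brA c m s n ∩ {y | c (m (brA c m s n) n) y = s n}

theorem brouwer [CompactSpace X] [Nonempty X] (c : ℕ → X → Bool)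
    (hc : ∀ n, Continuous (c n)) (hsep : ∀ x y, (∀ n, c n x = c n y) → x = y)
    (hperf : ∀ x : X, ¬ IsOpen ({x} : Set X)) : Nonempty (X ≃ₜ (ℕ → Bool)) := by
  classical
  have hcl : ∀ n b, IsClopen {y | c n y = b} := fun n b =>
    (isClopen_discrete {b}).preimage (hc n)
  have key : ∀ (A : Set X) (n : ℕ), ∃ m : ℕ, IsOpen A → A.Nonempty →
      (∀ b, (A ∩ {y | c m y = b}).Nonempty) ∧
      (∀ b, ∀ y ∈ A ∩ {y | c m y = b}, ∀ z ∈ A ∩ {y | c m y = b}, c n y = c n z) := by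
    intro A n
    by_cases h : IsOpen A ∧ A.Nonempty
    swap
    · exact ⟨0, fun h1 h2 => (h ⟨h1, h2⟩).elim⟩
    obtain ⟨hA, x, hx⟩ := h
    by_cases hcon : ∀ b, (A ∩ {y | c n y = b}).Nonempty
    · exact ⟨n, fun _ _ => ⟨hcon, fun b y hy z hz => hy.2.trans hz.2.symm⟩⟩
    have hcon' : ∀ y ∈ A, ∀ z ∈ A, c n y = c n z := by
      intro y hy z hz
      by_contra hne
      apply hcon
      intro b
      by_cases hb : c n y = b
      · exact ⟨y, hy, hb⟩
      · refine ⟨z, hz, ?_⟩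
        show c n z = b
        cases b <;> cases h1 : c n y <;> cases h2 : c n z <;> simp_all
    have : ∃ y ∈ A, y ≠ x := by
      by_contra hno
      push Not at hno
      apply hperf x
      have : A = {x} := by
        ext y
        exact ⟨fun hy => hno y hy, fun hy => by rw [hy]; exact hx⟩
      rwa [← this]
    obtain ⟨y, hy, hyx⟩ := this
    have : ∃ m, c m x ≠ c m y := by
      by_contra hno
      push Not at hno
      exact hyx (hsep x y hno).symm
    obtain ⟨m, hm⟩ := this
    refine ⟨m, fun _ _ => ⟨?_, fun b y hy z hz => hcon' y hy.1 z hz.1⟩⟩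
    intro b
    by_cases hb : c m y = b
    · exact ⟨y, hy, hb⟩
    · refine ⟨x, hx, ?_⟩
      show c m x = b
      cases b <;> cases h1 : c m y <;> cases h2 : c m x <;> simp_all
  choose m hm using key
  have Aop : ∀ s n, IsClopen (brA c m s n) := by
    intro s n
    induction n with
    | zero => exact isClopen_univ
    | succ n ih => exact ih.inter (hcl _ _)
  have Ane : ∀ s n, (brA c m s n).Nonempty := by
    intro s n
    induction n with
    | zero => exact Set.univ_nonempty
    | succ n ih => exact (hm _ n (Aop s n).isOpen ih).1 (s n)
  let f : X → ℕ → Bool := fun x n => c (m (brD c m x n) n) x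
  have hDA : ∀ x n, brD c m x n = brA c m (f x) n := by
    intro x n
    induction n with
    | zero => rfl
    | succ n ih =>
      show brD c m x n ∩ {y | c (m (brD c m x n) n) y = c (m (brD c m x n) n) x} =
        brA c m (f x) n ∩ {y | c (m (brA c m (f x) n) n) y = f x n}
      rw [← ih]
  have hxD : ∀ x n, x ∈ brD c m x n := by
    intro x n
    induction n with
    | zero => trivial
    | succ n ih => exact ⟨ih, rfl⟩
  have hmono : ∀ x n, ∀ y ∈ brD c m x n, brD c m y n = brD c m x n := by
    intro x n
    induction n with
    | zero => intros; rfl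
    | succ n ih =>
      intro y hy
      show brD c m y n ∩ {z | c (m (brD c m y n) n) z = c (m (brD c m y n) n) y} =
        brD c m x n ∩ {z | c (m (brD c m x n) n) z = c (m (brD c m x n) n) x}
      rw [ih y hy.1]
      have := hy.2
      simp only [Set.mem_setOf_eq] at this
      rw [this]
  have hcont : Continuous f := by
    refine continuous_pi fun n => ?_
    rw [continuous_iff_continuousAt]
    intro x
    have hev : ∀ᶠ y in nhds x, f x n = f y n := by
      have : brD c m x (n+1) ∈ nhds x := by
        rw [hDA]
        apply (Aop _ _).isOpen.mem_nhds
        rw [← hDA]; exact hxD x _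
      filter_upwards [this] with y hy
      have h1 := hmono x n y hy.1
      have h2 := hy.2
      simp only [Set.mem_setOf_eq] at h2
      show c (m (brD c m x n) n) x = c (m (brD c m y n) n) y
      rw [h1, h2]
    exact tendsto_const_nhds.congr' hev
  have hinj : Function.Injective f := by
    intro x y hxy
    apply hsep
    intro n
    have hy : y ∈ brD c m x (n+1) := by
      rw [hDA, hxy, ← hDA]; exact hxD y _
    have hx := hxD x (n+1)
    rw [hDA] at hx hy
    exact (hm _ n (Aop (f x) n).isOpen (Ane _ n)).2 (f x n) x hx y hy
  have hsurj : Function.Surjective f := by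
    intro s
    have hne : (⋂ n, brA c m s n).Nonempty := by
      apply IsCompact.nonempty_iInter_of_sequence_nonempty_isCompact_isClosed
      · intro n; exact Set.inter_subset_left
      · exact Ane s
      · exact (Aop s 0).isClosed.isCompact
      · exact fun n => (Aop s n).isClosed
    obtain ⟨x, hx⟩ := hne
    rw [Set.mem_iInter] at hx
    refine ⟨x, ?_⟩
    have hAD : ∀ n, brA c m s n = brD c m x n := by
      intro n
      induction n with
      | zero => rfl
      | succ n ih =>
        have := (hx (n+1)).2
        simp only [Set.mem_setOf_eq] at this
        show brA c m s n ∩ {y | c (m (brA c m s n) n) y = s n} =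
          brD c m x n ∩ {y | c (m (brD c m x n) n) y = c (m (brD c m x n) n) x}
        rw [← this, ih]
    funext n
    have := (hx (n+1)).2
    simp only [Set.mem_setOf_eq] at this
    rw [← this, hAD]
  exact ⟨Continuous.homeoOfEquivCompactToT2 (f := Equiv.ofBijective f ⟨hinj, hsurj⟩) hcont⟩
end Brouwer

section Torsion

theorem alg_count {F : Type*} [Group F] [Fintype F] [DecidableEq F] (w : F → ℤ)
    (t : (F → ℤ) → F) (rep : (F → ℤ) → (F → ℤ))
    (ht : ∀ v, (fun h => v (h * t v)) = rep v)
    (hrep : ∀ v k, rep (fun h => v (h * k)) = rep v)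
    (hw : ∑ h, w h = 0) :
    ∑ h, (if t (fun k => w (k * h⁻¹)) = h then w h⁻¹ else 0) = 0 := by
  classical
  by_cases hD : rep w = w
  swap
  · apply Finset.sum_eq_zero
    intro h _
    rw [if_neg]
    intro hh
    apply hD
    have h1 := ht (fun k => w (k * h⁻¹))
    rw [hrep, hh] at h1
    rw [← h1]
    funext k
    simp
  have hc : (0 : ℤ) < ∑ σ : F, (if (fun k => w (k * σ)) = w then 1 else 0) := by
    apply Finset.sum_pos'
    · intro i _; split_ifs <;> norm_num
    · exact ⟨1, Finset.mem_univ _, by simp⟩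
  have hmain : (∑ σ : F, (if (fun k => w (k * σ)) = w then (1:ℤ) else 0)) *
      ∑ h, (if t (fun k => w (k * h⁻¹)) = h then w h⁻¹ else 0) = 0 := by
    rw [Finset.sum_mul_sum, Finset.sum_comm]
    have h1 : ∀ h σ : F, (if (fun k => w (k * σ)) = w then (1:ℤ) else 0) *
        (if t (fun k => w (k * h⁻¹)) = h then w h⁻¹ else 0) =
        if t (fun k => w (k * (h⁻¹ * σ))) = h then w (h⁻¹ * σ) else 0 := by
      intro h σ
      by_cases hσ : (fun k => w (k * σ)) = w
      · have e : ∀ k, w (k * σ) = w k := fun k => congrFun hσ k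
        simp only [← mul_assoc, e, if_true, one_mul]
      · rw [if_neg hσ, zero_mul, if_neg]
        intro hh
        apply hσ
        have h2 := ht (fun k => w (k * (h⁻¹ * σ)))
        rw [hrep, hh, hD] at h2
        refine Eq.trans ?_ h2
        funext k
        congr 1
        group
    simp only [h1]
    have h2 : ∀ h : F, ∑ σ : F, (if t (fun k => w (k * (h⁻¹ * σ))) = h then w (h⁻¹ * σ) else 0)
        = ∑ σ : F, (if t (fun k => w (k * σ)) = h then w σ else 0) := fun h =>
      Fintype.sum_equiv (Equiv.mulLeft h⁻¹) _ _ (fun σ => rfl)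
    simp only [h2]
    rw [Finset.sum_comm]
    simpa using hw
  rcases mul_eq_zero.1 hmain with h | h
  · omega
  · exact h

variable {X : Type*} [TopologicalSpace X]

theorem finite_lemma (F : Subgroup (X ≃ₜ X)) [Finite F] (E : AddSubgroup (X → ℤ))
    (hE : ∀ g ∈ F, ∀ k : X → ℤ, Continuous k → k ∘ g - k ∈ E)
    (f : X → ℤ) (hf : Continuous f)
    (hs : ∀ x, ∑ᶠ g : F, f (g.1 x) = 0) : f ∈ E := by
  classical
  have := Fintype.ofFinite F
  let S : Setoid (F → ℤ) :=
    { r := fun v w => ∃ k : F, (fun h => v (h * k)) = w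
      iseqv := 
        { refl := fun v => ⟨1, by simp⟩
          symm := by
            rintro v w ⟨k, rfl⟩
            exact ⟨k⁻¹, by simp⟩
          trans := by
            rintro u v w ⟨k, rfl⟩ ⟨l, rfl⟩
            exact ⟨l * k, by simp [mul_assoc]⟩ } }
  let rep : (F → ℤ) → (F → ℤ) := fun v => (Quotient.mk S v).out
  have hex : ∀ v, ∃ k : F, (fun h => v (h * k)) = rep v := fun v =>
    S.symm (Quotient.mk_out (s := S) v)
  choose t ht using hex
  have hrep : ∀ v k, rep (fun h => v (h * k)) = rep v := by
    intro v k
    have : Quotient.mk S (fun h => v (h * k)) = Quotient.mk S v :=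
      Quotient.sound (S.symm ⟨k, rfl⟩)
    show (Quotient.mk S _).out = (Quotient.mk S v).out
    rw [this]
  let Φ : X → F → ℤ := fun x g => f (g.1 x)
  have hΦ : Continuous Φ := continuous_pi fun g => hf.comp g.1.continuous
  have hloc : IsLocallyConstant Φ := by
    rw [IsLocallyConstant.iff_eventually_eq]
    intro x
    have : ∀ g : F, ∀ᶠ y in nhds x, Φ y g = Φ x g := fun g =>
      (IsLocallyConstant.iff_continuous _).2 (hf.comp g.1.continuous) |>.eventually_eq x
    filter_upwards [Filter.eventually_all.2 this] with y hy
    exact funext hy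
  let fh : F → X → ℤ := fun h x => if t (Φ x) = h then f x else 0
  have hfh : ∀ h, Continuous (fh h) := by
    intro h
    have : fh h = (fun v : F → ℤ => if t v = h then v 1 else 0) ∘ Φ := by
      funext x; simp [fh, Φ]
    rw [this]
    exact (hloc.comp _).continuous
  have hq : ∀ x, ∑ h : F, fh h ((h⁻¹ : F).1 x) = 0 := by
    intro x
    have := alg_count (Φ x) t rep ht hrep (by rw [← hs x, finsum_eq_sum_of_fintype])
    rw [← this]
    rfl
  have hfeq : f = - ∑ h : F, (fh h ∘ (h⁻¹ : F).1 - fh h) := by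
    funext x
    simp only [Pi.neg_apply, Finset.sum_apply, Pi.sub_apply, Function.comp, Finset.sum_sub_distrib,
      hq x]
    simp [fh]
  rw [hfeq]
  exact E.neg_mem (E.sum_mem fun h _ => hE _ (h⁻¹).2 _ (hfh h))

variable {Γ : Type*} [Group Γ]

theorem full_mem (α : Γ →* X ≃ₜ X) (E : AddSubgroup (X → ℤ))
    (hE : ∀ γ, ∀ k : X → ℤ, Continuous k → k ∘ α γ - k ∈ E)
    (g : X ≃ₜ X) (hg : InTopFullGroup α g) (k : X → ℤ) (hk : Continuous k) : k ∘ g - k ∈ E := by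
  classical
  obtain ⟨n, P, γ, hP, hd, hU, hgP⟩ := hg
  have hQ : ∀ i, α (γ i) '' P i = g '' P i := fun i =>
    Set.image_congr fun x hx => (hgP i x hx).symm
  have hQc : ∀ i, IsClopen (α (γ i) '' P i) := fun i =>
    ⟨(α (γ i)).isClosedMap _ (hP i).1, (α (γ i)).isOpenMap _ (hP i).2⟩
  have huniq : ∀ x, ∃ i, x ∈ P i ∧ ∀ j, j ≠ i → x ∉ P j := by
    intro x
    have : x ∈ ⋃ i, P i := by rw [hU]; trivial
    obtain ⟨i, hi⟩ := Set.mem_iUnion.1 this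
    exact ⟨i, hi, fun j hj hx => Set.disjoint_left.1 (hd hj) hx hi⟩
  have heq : k ∘ g - k = ∑ i, ((α (γ i) '' P i).indicator k ∘ α (γ i)
      - (α (γ i) '' P i).indicator k) := by
    funext x
    simp only [Finset.sum_apply, Pi.sub_apply, Function.comp, Finset.sum_sub_distrib]
    congr 1
    · obtain ⟨i, hi, hj⟩ := huniq x
      rw [Finset.sum_eq_single i]
      · rw [Set.indicator_of_mem (Set.mem_image_of_mem _ hi), hgP i x hi]
      · intro j _ hji
        rw [Set.indicator_of_notMem]
        rintro ⟨y, hy, hyx⟩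
        rw [(α (γ j)).injective hyx] at hy
        exact hj j hji hy
      · simp
    · obtain ⟨i, hi, hj⟩ := huniq (g.symm x)
      rw [Finset.sum_eq_single i]
      · rw [Set.indicator_of_mem]
        rw [hQ]
        exact ⟨_, hi, g.apply_symm_apply x⟩
      · intro j _ hji
        rw [Set.indicator_of_notMem]
        rw [hQ]
        rintro ⟨y, hy, hyx⟩
        rw [← hyx, g.symm_apply_apply] at hj
        exact hj j hji hy
      · simp
  rw [heq]
  refine E.sum_mem fun i _ => hE _ _ ?_
  exact continuous_indicator (by simp [(hQc i).frontier_eq]) hk.continuousOn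

theorem dense_move [CompactSpace X] (α : Γ →* X ≃ₜ X) (Λ : Subgroup (X ≃ₜ X))
    (hΛ : ∀ g : X ≃ₜ X, InTopFullGroup α g →
      ∀ (n : ℕ) (P : Fin n → Set X), (∀ i, IsClopen (P i)) →
        (Pairwise fun i j => Disjoint (P i) (P j)) → (⋃ i, P i) = Set.univ →
        ∃ l ∈ Λ, ∀ i, ⇑l '' P i = ⇑g '' P i)
    (γ : Γ) (k : X → ℤ) (hk : Continuous k) : ∃ l ∈ Λ, ∀ x, k (α γ x) = k (l x) := by
  have hfin : (Set.range k).Finite := (isCompact_range hk).finite_of_discrete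
  obtain ⟨n, ⟨e⟩⟩ := hfin.exists_equiv_fin
  have hin : InTopFullGroup α (α γ⁻¹) :=
    ⟨1, fun _ => Set.univ, fun _ => γ⁻¹, fun _ => isClopen_univ,
      fun i j h => (h (Subsingleton.elim _ _)).elim, Set.iUnion_const _, fun _ _ _ => rfl⟩
  obtain ⟨l, hl, hlP⟩ := hΛ (α γ⁻¹) hin n (fun i => k ⁻¹' {(e.symm i).1})
    (fun i => (isClopen_discrete _).preimage hk)
    (by
      intro i j hij
      apply Set.disjoint_left.2
      intro x hx hy
      apply hij
      apply e.symm.injective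
      apply Subtype.ext
      exact hx.symm.trans hy)
    (by
      rw [Set.eq_univ_iff_forall]
      intro x
      exact Set.mem_iUnion.2 ⟨e ⟨k x, x, rfl⟩, by simp⟩)
  refine ⟨l⁻¹, Λ.inv_mem hl, fun x => ?_⟩
  have h1 : x ∈ l '' (k ⁻¹' {k (l⁻¹ x)}) := ⟨l⁻¹ x, rfl, l.apply_symm_apply x⟩
  have h2 := hlP (e ⟨k (l⁻¹ x), _, rfl⟩)
  simp only [Equiv.symm_apply_apply] at h2
  rw [h2] at h1
  obtain ⟨y, hy, rfl⟩ := h1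
  have h3 : α γ (α γ⁻¹ y) = y := by
    have : (α γ * α γ⁻¹) y = y := by rw [← map_mul, mul_inv_cancel, map_one]; rfl
    exact this
  rw [h3]; exact hy

theorem torsion_free [CompactSpace X] (α : Γ →* X ≃ₜ X) (E : AddSubgroup (X → ℤ))
    (hE : ∀ γ, ∀ k : X → ℤ, Continuous k → k ∘ α γ - k ∈ E)
    (f k l : X → ℤ) (hf : Continuous f) (hk : Continuous k) (hl : Continuous l)
    (γ₁ γ₂ : Γ) (h2 : ∀ x, 2 * f x = (k (α γ₁ x) - k x) + (l (α γ₂ x) - l x))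
    (hD : HasDenseLocallyFiniteSubgroup α) : f ∈ E := by
  classical
  obtain ⟨Λ, hΛ, hfin, hdense⟩ := hD
  obtain ⟨a, ha, hka⟩ := dense_move α Λ hdense γ₁ k hk
  obtain ⟨b, hb, hlb⟩ := dense_move α Λ hdense γ₂ l hl
  have hsub : (({a, b} : Finset (X ≃ₜ X)) : Set (X ≃ₜ X)) ⊆ (Λ : Set (X ≃ₜ X)) := by
    intro x hx
    simp at hx
    rcases hx with rfl | rfl <;> assumption
  set F := Subgroup.closure ((({a, b} : Finset (X ≃ₜ X)) : Set (X ≃ₜ X))) with hF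
  haveI hFf : Finite F := hfin {a, b} hsub
  have hFΛ : F ≤ Λ := (Subgroup.closure_le _).2 hsub
  have haF : a ∈ F := Subgroup.subset_closure (by simp)
  have hbF : b ∈ F := Subgroup.subset_closure (by simp)
  refine finite_lemma F E (fun g hg k hk => full_mem α E hE g (hΛ (hFΛ hg)) k hk) f hf ?_
  intro x
  have := Fintype.ofFinite F
  rw [finsum_eq_sum_of_fintype]
  have h3 : ∀ (c : X ≃ₜ X) (hc : c ∈ F) (k : X → ℤ),
      ∑ g : F, k (c (g.1 x)) = ∑ g : F, k (g.1 x) := fun c hc k =>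
    Fintype.sum_equiv (Equiv.mulLeft ⟨c, hc⟩) _ _ (fun σ => rfl)
  have : 2 * ∑ g : F, f (g.1 x) = 0 := by
    rw [Finset.mul_sum]
    simp only [h2, hka, hlb, Finset.sum_add_distrib, Finset.sum_sub_distrib, h3 a haF, h3 b hbF]
    ring
  omega

end Torsion

section Toeplitz

def Pat (ρ : ℤ) (x : ℤ → Bool) : Prop :=
  ∀ m : ℤ, x (5 * m + ρ + 1) = false ∧ x (5 * m + ρ + 2) = false ∧
    x (5 * m + ρ + 3) = true ∧ x (5 * m + ρ + 4) = true

def Good : ℕ → (ℤ → Bool) → Prop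
  | 0, _ => True
  | k + 1, x => ∃ ρ : ℤ, Pat ρ x ∧ Good k (fun m => x (5 * m + ρ))

def XS : Set (ℤ → Bool) := {x | ∀ k, Good k x}

theorem Pat.sh {ρ : ℤ} {x : ℤ → Bool} (h : Pat ρ x) (n : ℤ) :
    Pat (ρ - n) (fun i => x (i + n)) := by
  intro m
  have := h m
  refine ⟨?_, ?_, ?_, ?_⟩
  · rw [← this.1]; congr 1; ring
  · rw [← this.2.1]; congr 1; ring
  · rw [← this.2.2.1]; congr 1; ring
  · rw [← this.2.2.2]; congr 1; ring

theorem Good.sh {k : ℕ} {x : ℤ → Bool} (h : Good k x) (n : ℤ) :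
    Good k (fun i => x (i + n)) := by
  cases k with
  | zero => trivial
  | succ k =>
    obtain ⟨ρ, hp, hg⟩ := h
    refine ⟨ρ - n, hp.sh n, ?_⟩
    have : (fun m : ℤ => x (5 * m + (ρ - n) + n)) = (fun m => x (5 * m + ρ)) := by
      funext m; congr 1; ring
    show Good k (fun m : ℤ => x (5 * m + (ρ - n) + n))
    rw [this]; exact hg

theorem XS_sh {x : ℤ → Bool} (h : x ∈ XS) (n : ℤ) : (fun i => x (i + n)) ∈ XS :=
  fun k => (h k).sh n

theorem Pat.add {ρ : ℤ} {x : ℤ → Bool} (h : Pat ρ x) (q : ℤ) : Pat (ρ + 5 * q) x := by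
  intro m
  have := h (m + q)
  refine ⟨?_, ?_, ?_, ?_⟩
  · rw [← this.1]; congr 1; ring
  · rw [← this.2.1]; congr 1; ring
  · rw [← this.2.2.1]; congr 1; ring
  · rw [← this.2.2.2]; congr 1; ring

theorem good_add {k : ℕ} {ρ : ℤ} {x : ℤ → Bool} (h : Good k (fun m => x (5 * m + ρ))) (q : ℤ) :
    Good k (fun m => x (5 * m + (ρ + 5 * q))) := by
  have := h.sh q
  convert this using 3
  ring

theorem Pat.unique {ρ ρ' : ℤ} {x : ℤ → Bool} (h : Pat ρ x) (h' : Pat ρ' x) :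
    ∃ q : ℤ, ρ = ρ' + 5 * q := by
  have h0 : ρ' - ρ = 5 * ((ρ' - ρ) / 5) + (ρ' - ρ) % 5 := by omega
  have hlt : (ρ' - ρ) % 5 < 5 := by omega
  have hge : 0 ≤ (ρ' - ρ) % 5 := by omega
  generalize (ρ' - ρ) % 5 = s at *
  generalize (ρ' - ρ) / 5 = q at *
  obtain rfl : ρ' = ρ + 5 * q + s := by omega
  interval_cases s
  · exact ⟨-q, by ring⟩
  · have h1 := (h' 0).2.1
    have h2 := (h q).2.2.1
    rw [show 5 * 0 + (ρ + 5 * q + 1) + 2 = 5 * q + ρ + 3 by ring, h2] at h1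
    exact absurd h1 (by simp)
  · have h1 := (h' 0).1
    have h2 := (h q).2.2.1
    rw [show 5 * 0 + (ρ + 5 * q + 2) + 1 = 5 * q + ρ + 3 by ring, h2] at h1
    exact absurd h1 (by simp)
  · have h1 := (h' 0).1
    have h2 := (h q).2.2.2
    rw [show 5 * 0 + (ρ + 5 * q + 3) + 1 = 5 * q + ρ + 4 by ring, h2] at h1
    exact absurd h1 (by simp)
  · have h1 := (h' 0).2.2.1
    have h2 := (h (q+1)).2.1
    rw [show 5 * 0 + (ρ + 5 * q + 4) + 3 = 5 * (q+1) + ρ + 2 by ring, h2] at h1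
    exact absurd h1 (by simp)

theorem desub {x : ℤ → Bool} (hx : x ∈ XS) (lo : ℤ) : ∃ ρ : ℤ, lo ≤ ρ ∧ ρ < lo + 5 ∧ Pat ρ x ∧
    (fun m => x (5 * m + ρ)) ∈ XS := by
  obtain ⟨ρ₀, hp, -⟩ := hx 1
  refine ⟨ρ₀ + 5 * (-((ρ₀ - lo) / 5)), by omega, by omega, hp.add _, ?_⟩
  intro k
  obtain ⟨ρ₁, hp₁, hg⟩ := hx (k+1)
  obtain ⟨q, hq⟩ := (hp.add (-((ρ₀ - lo) / 5))).unique hp₁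
  rw [hq]
  exact good_add hg q

theorem isClosed_Good (k : ℕ) : IsClosed {x | Good k x} := by
  induction k with
  | zero => exact isClosed_univ
  | succ k ih =>
    have : {x | Good (k+1) x} = ⋃ ρ ∈ (Finset.Ico (0:ℤ) 5 : Set ℤ),
        ({x | Pat ρ x} ∩ (fun (x : ℤ → Bool) (m : ℤ) => x (5 * m + ρ)) ⁻¹' {x | Good k x}) := by
      ext x
      simp only [Set.mem_iUnion]
      constructor
      · rintro ⟨ρ, hp, hg⟩
        refine ⟨ρ + 5 * (- (ρ / 5)), ?_, hp.add _, good_add hg _⟩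
        simp; omega
      · rintro ⟨ρ, -, hp, hg⟩
        exact ⟨ρ, hp, hg⟩
    rw [this]
    refine Set.Finite.isClosed_biUnion (Finset.finite_toSet _) fun ρ _ => ?_
    refine IsClosed.inter ?_ (ih.preimage (by fun_prop))
    simp only [Pat, Set.setOf_forall]
    refine isClosed_iInter fun m => ?_
    refine (isClosed_eq (continuous_apply _) continuous_const).inter
      ((isClosed_eq (continuous_apply _) continuous_const).inter
      ((isClosed_eq (continuous_apply _) continuous_const).inter
      (isClosed_eq (continuous_apply _) continuous_const)))

theorem isClosed_XS : IsClosed XS := by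
  have : XS = ⋂ k, {x | Good k x} := by ext; simp [XS]
  rw [this]
  exact isClosed_iInter isClosed_Good

def x0 (n : ℤ) : Bool := decide (3 ≤ (n / 5 ^ (padicValInt 5 n)) % 5)

theorem x0_mul (m : ℤ) : x0 (5 * m + 0) = x0 m := by
  rw [add_zero]
  by_cases hm : m = 0
  · simp [hm]
  have : Fact (Nat.Prime 5) := ⟨by norm_num⟩
  have h1 : padicValInt 5 (5 * m) = padicValInt 5 m + 1 := by
    rw [padicValInt.mul (by norm_num) hm]
    have : padicValInt 5 (5:ℤ) = 1 := by exact_mod_cast padicValInt.self (p := 5) (by norm_num)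
    omega
  unfold x0
  rw [h1, pow_succ, mul_comm (5^_) (5:ℤ), Int.mul_ediv_mul_of_pos _ _ (by norm_num)]

theorem x0_not (n : ℤ) (h : n % 5 ≠ 0) : x0 n = decide (3 ≤ n % 5) := by
  have : padicValInt 5 n = 0 := padicValInt.eq_zero_of_not_dvd (by push_cast; omega)
  simp [x0, this]

theorem x0_mem : x0 ∈ XS := by
  intro k
  induction k with
  | zero => trivial
  | succ k ih =>
    refine ⟨0, ?_, ?_⟩
    · intro m
      refine ⟨?_, ?_, ?_, ?_⟩ <;> rw [x0_not _ (by omega)]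
      · simp
      · simp
      · simp
      · simp
    · simp only [x0_mul]; exact ih

theorem aper {x : ℤ → Bool} (hx : x ∈ XS) {n : ℤ} (h : ∀ i, x (i + n) = x i) : n = 0 := by
  induction hN : n.natAbs using Nat.strong_induction_on generalizing x n with
  | _ N ih =>
    obtain ⟨ρ, -, -, hp, hy⟩ := desub hx 0
    have h1 := hp.sh n
    simp only [h] at h1
    obtain ⟨q, hq⟩ := hp.unique h1
    by_contra hne
    have : q = 0 := by
      refine ih q.natAbs (by omega) hy (n := q) (fun i => ?_) rfl
      show x (5 * (i + q) + ρ) = x (5 * i + ρ)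
      rw [← h (5 * i + ρ)]
      congr 1; omega
    omega

abbrev GG := ZMod 2 × ZMod 2

def ee (b : Bool) : GG := if b then (0, 1) else (1, 0)

def ss (x : ℤ → Bool) (N : ℕ) : GG := ∑ i ∈ Finset.range N, ee (x i)

theorem ss_succ (x : ℤ → Bool) (N : ℕ) : ss x (N+1) = ss x N + ee (x N) :=
  Finset.sum_range_succ _ _

theorem ss_block {x : ℤ → Bool} {ρ : ℤ} (hp : Pat ρ x) (δ : ℕ) (h1 : (δ:ℤ) ≤ ρ) (h2 : ρ < δ + 5)
    (M : ℕ) : ss x (δ + 5 * M) = ss x δ + ss (fun m => x (5 * m + ρ)) M := by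
  induction M with
  | zero => simp [ss]
  | succ M ih =>
    rw [show δ + 5 * (M+1) = δ + 5 * M + 1 + 1 + 1 + 1 + 1 by ring]
    simp only [ss_succ]
    rw [ih]
    obtain ⟨c, hc⟩ : ∃ c : ℤ, ρ = δ + c := ⟨ρ - δ, by ring⟩
    have hc0 : 0 ≤ c := by omega
    have hc5 : c < 5 := by omega
    obtain ⟨a1, a2, a3, a4⟩ := hp M
    obtain ⟨b1, b2, b3, b4⟩ := hp (M-1)
    subst hc
    push_cast
    have key : ∀ A B p q r s t z : GG, p + (q + (r + (s + t))) = z →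
        A + B + p + q + r + s + t = A + (B + z) := by
      intros; subst_vars; abel
    refine key _ _ _ _ _ _ _ _ ?_
    generalize hz : x (5 * (M:ℤ) + (δ + c)) = z
    interval_cases c
    · rw [show (δ:ℤ) + 5 * M + 4 = 5 * M + (δ + 0) + 4 by ring, a4,
        show (δ:ℤ) + 5 * M + 3 = 5 * M + (δ + 0) + 3 by ring, a3,
        show (δ:ℤ) + 5 * M + 2 = 5 * M + (δ + 0) + 2 by ring, a2,
        show (δ:ℤ) + 5 * M + 1 = 5 * M + (δ + 0) + 1 by ring, a1,
        show (δ:ℤ) + 5 * M = 5 * M + (δ + 0) by ring, hz]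
      clear hz; revert z; decide
    · rw [show (δ:ℤ) + 5 * M + 4 = 5 * M + (δ + 1) + 3 by ring, a3,
        show (δ:ℤ) + 5 * M + 3 = 5 * M + (δ + 1) + 2 by ring, a2,
        show (δ:ℤ) + 5 * M + 2 = 5 * M + (δ + 1) + 1 by ring, a1,
        show (δ:ℤ) + 5 * M + 1 = 5 * M + (δ + 1) by ring, hz,
        show (δ:ℤ) + 5 * M = 5 * (M-1) + (δ + 1) + 4 by ring, b4]
      clear hz; revert z; decide
    · rw [show (δ:ℤ) + 5 * M + 4 = 5 * M + (δ + 2) + 2 by ring, a2,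
        show (δ:ℤ) + 5 * M + 3 = 5 * M + (δ + 2) + 1 by ring, a1,
        show (δ:ℤ) + 5 * M + 2 = 5 * M + (δ + 2) by ring, hz,
        show (δ:ℤ) + 5 * M + 1 = 5 * (M-1) + (δ + 2) + 4 by ring, b4,
        show (δ:ℤ) + 5 * M = 5 * (M-1) + (δ + 2) + 3 by ring, b3]
      clear hz; revert z; decide
    · rw [show (δ:ℤ) + 5 * M + 4 = 5 * M + (δ + 3) + 1 by ring, a1,
        show (δ:ℤ) + 5 * M + 3 = 5 * M + (δ + 3) by ring, hz,
        show (δ:ℤ) + 5 * M + 2 = 5 * (M-1) + (δ + 3) + 4 by ring, b4,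
        show (δ:ℤ) + 5 * M + 1 = 5 * (M-1) + (δ + 3) + 3 by ring, b3,
        show (δ:ℤ) + 5 * M = 5 * (M-1) + (δ + 3) + 2 by ring, b2]
      clear hz; revert z; decide
    · rw [show (δ:ℤ) + 5 * M + 4 = 5 * M + (δ + 4) by ring, hz,
        show (δ:ℤ) + 5 * M + 3 = 5 * (M-1) + (δ + 4) + 4 by ring, b4,
        show (δ:ℤ) + 5 * M + 2 = 5 * (M-1) + (δ + 4) + 3 by ring, b3,
        show (δ:ℤ) + 5 * M + 1 = 5 * (M-1) + (δ + 4) + 2 by ring, b2,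
        show (δ:ℤ) + 5 * M = 5 * (M-1) + (δ + 4) + 1 by ring, b1]
      clear hz; revert z; decide

theorem exists_val {x : ℤ → Bool} (hx : x ∈ XS) (b : Bool) : ∃ t : ℕ, x ((t:ℤ) + 1) = b := by
  obtain ⟨ρ, h0, -, hp, -⟩ := desub hx 0
  lift ρ to ℕ using h0
  obtain ⟨h1, -, h3, -⟩ := hp 0
  cases b
  · exact ⟨ρ, by rw [← h1]; congr 1; ring⟩
  · exact ⟨ρ + 2, by rw [← h3]; congr 1; push_cast; ring⟩

theorem reach_base {x : ℤ → Bool} (hx : x ∈ XS) (h : Bool) (g : GG) :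
    ∃ N : ℕ, x N = h ∧ ss x N = g := by
  obtain ⟨ρ, h0, -, hp, hy⟩ := desub hx 0
  lift ρ to ℕ using h0
  set y : ℤ → Bool := fun m => x (5 * m + ρ) with hydef
  have hS : ∀ m : ℕ, ss x (ρ + 5 * m + 1) = ss x ρ + ss y (m+1) := by
    intro m
    rw [ss_succ, ss_succ, ss_block hp ρ le_rfl (by omega), add_assoc]
    congr 3
    simp only [hydef]
    congr 1; push_cast; ring
  have pos : ∀ m : ℕ, x ((ρ + 5 * m + 1 : ℕ) : ℤ) = false ∧ x ((ρ + 5 * m + 1 + 1 : ℕ) : ℤ) = false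
      ∧ x ((ρ + 5 * m + 1 + 1 + 1 : ℕ) : ℤ) = true
      ∧ x ((ρ + 5 * m + 1 + 1 + 1 + 1 : ℕ) : ℤ) = true := by
    intro m
    obtain ⟨a1, a2, a3, a4⟩ := hp m
    refine ⟨?_, ?_, ?_, ?_⟩
    · rw [← a1]; congr 1; push_cast; ring
    · rw [← a2]; congr 1; push_cast; ring
    · rw [← a3]; congr 1; push_cast; ring
    · rw [← a4]; congr 1; push_cast; ring
  obtain ⟨t, ht⟩ := exists_val hy (!h)
  have hstep : ss x (ρ + 5 * (t+1) + 1) = ss x (ρ + 5 * t + 1) + ee (!h) := by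
    rw [hS, hS, ss_succ y (t+1), ← ht, add_assoc]
    push_cast; rfl
  -- find m with the right coordinate
  have hm : ∃ m : ℕ, ss x (ρ + 5 * m + 1) = g ∨ ss x (ρ + 5 * m + 1) + ee h = g := by
    have : ∀ (S g : GG) (h : Bool), S = g ∨ S + ee h = g ∨ S + ee (!h) = g ∨
        S + ee (!h) + ee h = g := by decide
    rcases this (ss x (ρ + 5 * t + 1)) g h with h' | h' | h' | h'
    · exact ⟨t, Or.inl h'⟩
    · exact ⟨t, Or.inr h'⟩
    · exact ⟨t + 1, Or.inl (by rw [hstep, h'])⟩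
    · exact ⟨t + 1, Or.inr (by rw [hstep, h'])⟩
  obtain ⟨m, hm⟩ := hm
  obtain ⟨p1, p2, p3, p4⟩ := pos m
  have hcc : ∀ S : GG, S + ee false + ee false = S := by decide
  cases h
  · rcases hm with hm | hm
    · exact ⟨_, p1, hm⟩
    · exact ⟨_, p2, by rw [ss_succ, p1, hm]⟩
  · rcases hm with hm | hm
    · exact ⟨_, p3, by rw [ss_succ, ss_succ, p1, p2, hcc, hm]⟩
    · exact ⟨_, p4, by rw [ss_succ, ss_succ, ss_succ, p1, p2, p3, hcc, hm]⟩

theorem reach_one (r : ℕ) : ∀ {x x' : ℤ → Bool}, x ∈ XS → x' ∈ XS → ∀ g : GG,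
    ∃ N : ℕ, (∀ n : ℤ, 0 ≤ n → n < r → x (n + N) = x' n) ∧ ss x N = g := by
  induction r using Nat.strong_induction_on with
  | _ r ih =>
    intro x x' hx hx' g
    by_cases hr : r ≤ 1
    · obtain ⟨N, h1, h2⟩ := reach_base hx (x' 0) g
      refine ⟨N, fun n hn hn' => ?_, h2⟩
      obtain rfl : n = 0 := by omega
      rw [zero_add, h1]
    obtain ⟨ρ, h1, h2, hp, hy⟩ := desub hx 4
    obtain ⟨ρ', h1', h2', hp', hy'⟩ := desub hx' 0
    obtain ⟨δ, hδ⟩ : ∃ δ : ℕ, (δ : ℤ) = ρ - ρ' := ⟨(ρ - ρ').toNat, by omega⟩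
    obtain ⟨M, hM, hMs⟩ := ih ((r + 4) / 5) (by omega) hy hy' (g - ss x δ)
    refine ⟨δ + 5 * M, fun n hn hn' => ?_, ?_⟩
    · obtain ⟨m, j, hnj, hj0, hj5⟩ : ∃ m j : ℤ, n = 5 * m + ρ' + j ∧ 0 ≤ j ∧ j < 5 :=
        ⟨(n - ρ') / 5, (n - ρ') % 5, by omega, by omega, by omega⟩
      have e : n + ((δ + 5 * M : ℕ) : ℤ) = 5 * (m + M) + ρ + j := by push_cast; omega
      rw [e, hnj]
      obtain ⟨a1, a2, a3, a4⟩ := hp (m + M)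
      obtain ⟨b1, b2, b3, b4⟩ := hp' m
      interval_cases j
      · simpa using hM m (by omega) (by omega)
      · rw [a1, b1]
      · rw [a2, b2]
      · rw [a3, b3]
      · rw [a4, b4]
    · rw [ss_block hp δ (by omega) (by omega), hMs]; abel

theorem ss_add (x : ℤ → Bool) (N r : ℕ) :
    ss x (N + r) = ss x N + ∑ i ∈ Finset.range r, ee (x (i + N)) := by
  unfold ss
  rw [Finset.sum_range_add]
  congr 1
  refine Finset.sum_congr rfl fun i _ => ?_
  push_cast; rw [add_comm]

theorem reach {x x' : ℤ → Bool} (hx : x ∈ XS) (hx' : x' ∈ XS) (g : GG) (r : ℕ) :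
    ∃ N : ℕ, (∀ n : ℤ, -r ≤ n → n ≤ r → x (n + N) = x' n) ∧ ss x N = g := by
  obtain ⟨N, hN, hs⟩ := reach_one (2 * r + 1) hx (XS_sh hx' (-r))
    (g - ∑ i ∈ Finset.range r, ee (x' (i + -r)))
  refine ⟨N + r, fun n h1 h2 => ?_, ?_⟩
  · have := hN (n + r) (by omega) (by push_cast; omega)
    simp only [add_neg_cancel_right] at this
    rw [← this]; congr 1; push_cast; ring
  · rw [ss_add, hs]
    have : ∑ i ∈ Finset.range r, ee (x (i + N)) = ∑ i ∈ Finset.range r, ee (x' (i + -r)) := by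
      refine Finset.sum_congr rfl fun i hi => ?_
      rw [Finset.mem_range] at hi
      rw [← hN i (by omega) (by push_cast; omega)]
    rw [this]; abel

end Toeplitz

section System

def TT (n : ℤ) (x : XS) : XS := ⟨fun i => x.1 (i + n), XS_sh x.2 n⟩

theorem TT_TT (m n : ℤ) (x : XS) : TT m (TT n x) = TT (m + n) x := by
  apply Subtype.ext; funext i; simp only [TT]; congr 1; ring

theorem TT_zero (x : XS) : TT 0 x = x := by
  apply Subtype.ext; funext i; simp [TT]

theorem TT_cont (n : ℤ) : Continuous (TT n) := by
  have : Continuous (fun x : XS => (fun i : ℤ => x.1 (i + n))) :=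
    continuous_pi fun i => (continuous_apply (i + n)).comp continuous_subtype_val
  exact this.subtype_mk _

abbrev ZZ := XS × XS × GG

instance : CompactSpace XS := isCompact_iff_compactSpace.mp isClosed_XS.isCompact

theorem coord_cont (n : ℤ) : Continuous (fun x : XS => x.1 n) :=
  (continuous_apply n).comp continuous_subtype_val

theorem ee_cont (n : ℤ) : Continuous (fun x : XS => ee (x.1 n)) :=
  (continuous_of_discreteTopology (f := ee)).comp (coord_cont n)

def phi : ZZ ≃ₜ ZZ where
  toFun z := (TT 1 z.1, z.2.1, z.2.2 + ee (z.1.1 0))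
  invFun z := (TT (-1) z.1, z.2.1, z.2.2 - ee (z.1.1 (-1)))
  left_inv z := by
    obtain ⟨x, y, g⟩ := z
    simp only [TT_TT]
    simp [TT, TT_zero]
  right_inv z := by
    obtain ⟨x, y, g⟩ := z
    simp only [TT_TT]
    simp [TT, TT_zero]
  continuous_toFun := by
    have := (ee_cont 0).comp (continuous_fst (X := XS) (Y := XS × GG))
    refine ((TT_cont 1).comp continuous_fst).prodMk
      ((continuous_fst.comp continuous_snd).prodMk ?_)
    exact (continuous_snd.comp continuous_snd).add this
  continuous_invFun := by
    have := (ee_cont (-1)).comp (continuous_fst (X := XS) (Y := XS × GG))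
    refine ((TT_cont (-1)).comp continuous_fst).prodMk
      ((continuous_fst.comp continuous_snd).prodMk ?_)
    exact (continuous_snd.comp continuous_snd).sub this

def sig : ZZ ≃ₜ ZZ where
  toFun z := (z.2.1, z.1, z.2.2)
  invFun z := (z.2.1, z.1, z.2.2)
  left_inv _ := rfl
  right_inv _ := rfl
  continuous_toFun := by fun_prop
  continuous_invFun := by fun_prop

def psi : ZZ ≃ₜ ZZ := sig * phi * sig⁻¹

theorem sig_inv : sig⁻¹ = sig := rfl

theorem hmul {X : Type*} [TopologicalSpace X] (g h : X ≃ₜ X) (x : X) : (g * h) x = g (h x) := rfl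
theorem hone {X : Type*} [TopologicalSpace X] (x : X) : (1 : X ≃ₜ X) x = x := rfl

theorem phi_apply (z : ZZ) : phi z = (TT 1 z.1, z.2.1, z.2.2 + ee (z.1.1 0)) := rfl
theorem psi_apply (z : ZZ) : psi z = (z.1, TT 1 z.2.1, z.2.2 + ee (z.2.1.1 0)) := rfl

theorem phi_psi : Commute phi psi := by
  refine Homeomorph.ext fun z => ?_
  simp only [hmul, phi_apply, psi_apply]
  congr 2
  abel

theorem phi_pow (N : ℕ) (z : ZZ) : (phi ^ N) z = (TT N z.1, z.2.1, z.2.2 + ss z.1.1 N) := by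
  induction N with
  | zero => simp [hone, TT_zero, ss]
  | succ N ih =>
    rw [pow_succ', hmul, ih, phi_apply]
    simp only [TT_TT, ss_succ]
    simp [TT, add_comm, add_assoc]

theorem psi_pow (N : ℕ) (z : ZZ) : (psi ^ N) z = (z.1, TT N z.2.1, z.2.2 + ss z.2.1.1 N) := by
  rw [psi, conj_pow, hmul, hmul, phi_pow]; rfl

theorem phi_zpow (a : ℤ) (z : ZZ) : ((phi ^ a) z).1 = TT a z.1 ∧ ((phi ^ a) z).2.1 = z.2.1 := by
  obtain ⟨N, rfl | rfl⟩ := a.eq_nat_or_neg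
  · rw [zpow_natCast, phi_pow]; simp
  · have h : (phi ^ N) ((phi ^ (-(N:ℤ))) z) = z := by
      rw [← hmul, ← zpow_natCast, ← zpow_add]; simp [hone]
    rw [phi_pow] at h
    generalize (phi ^ (-(N:ℤ))) z = w at *
    subst h
    simp [TT_TT, TT_zero]

theorem psi_zpow (a : ℤ) (z : ZZ) : ((psi ^ a) z).1 = z.1 ∧ ((psi ^ a) z).2.1 = TT a z.2.1 := by
  rw [psi, conj_zpow, hmul, hmul]
  have := phi_zpow a (sig⁻¹ z)
  exact ⟨this.2, this.1⟩

def act0 : Multiplicative (ℤ × ℤ) →* (ZZ ≃ₜ ZZ) where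
  toFun γ := phi ^ γ.toAdd.1 * psi ^ γ.toAdd.2
  map_one' := by simp
  map_mul' a b := by
    simp only [toAdd_mul, Prod.fst_add, Prod.snd_add, zpow_add]
    have := (phi_psi.zpow_zpow b.toAdd.1 a.toAdd.2).eq
    simp only [mul_assoc]
    rw [← mul_assoc (phi ^ b.toAdd.1) (psi ^ a.toAdd.2), this]
    simp only [mul_assoc]

theorem act0_apply (γ : Multiplicative (ℤ × ℤ)) : act0 γ = phi ^ γ.toAdd.1 * psi ^ γ.toAdd.2 := rfl

theorem aperT (x : XS) (n : ℤ) (h : TT n x = x) : n = 0 :=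
  aper x.2 fun i => congrFun (congrArg Subtype.val h) i

theorem act0_free (γ : Multiplicative (ℤ × ℤ)) (z : ZZ) (h : act0 γ z = z) : γ = 1 := by
  rw [act0_apply, hmul] at h
  have h1 := phi_zpow γ.toAdd.1 ((psi ^ γ.toAdd.2) z)
  have h2 := psi_zpow γ.toAdd.2 z
  rw [h, h2.1, h2.2] at h1
  have a1 := aperT _ _ h1.1.symm
  have a2 := aperT _ _ h1.2.symm
  apply Multiplicative.toAdd.injective
  exact Prod.ext a1 a2

theorem tendsto_XS {x' : XS} {u : ℕ → XS}
    (h : ∀ r : ℕ, ∀ n : ℤ, -r ≤ n → n ≤ r → (u r).1 n = x'.1 n) :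
    Filter.Tendsto u Filter.atTop (nhds x') := by
  rw [tendsto_subtype_rng, tendsto_pi_nhds]
  intro n
  apply tendsto_const_nhds.congr'
  filter_upwards [Filter.eventually_ge_atTop n.natAbs] with r hr
  exact (h r n (by omega) (by omega)).symm

theorem dense_nat (z z' : ZZ) :
    z' ∈ closure {w | ∃ N M : ℕ, w = (phi ^ N) ((psi ^ M) z)} := by
  obtain ⟨x, y, g⟩ := z
  obtain ⟨x', y', g'⟩ := z'
  choose N hN1 hN2 using fun r : ℕ => reach x.2 x'.2 (g' - g) r
  choose M hM1 hM2 using fun r : ℕ => reach y.2 y'.2 0 r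
  have hu : Filter.Tendsto (fun r : ℕ => ((TT (N r) x, TT (M r) y, g') : ZZ)) Filter.atTop
      (nhds (x', y', g')) :=
    (tendsto_XS hN1).prodMk_nhds ((tendsto_XS hM1).prodMk_nhds tendsto_const_nhds)
  refine mem_closure_of_tendsto hu (Filter.Eventually.of_forall fun r => ⟨N r, M r, ?_⟩)
  rw [psi_pow, phi_pow]
  simp [hN2, hM2]

theorem nat_act (N M : ℕ) (z : ZZ) :
    (phi ^ N) ((psi ^ M) z) = act0 (Multiplicative.ofAdd ((N:ℤ), (M:ℤ))) z := by
  rw [act0_apply, hmul]; simp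

theorem act0_min (z : ZZ) : Dense (Set.range fun γ : Multiplicative (ℤ × ℤ) => act0 γ z) := by
  intro z'
  refine closure_mono ?_ (dense_nat z z')
  rintro _ ⟨N, M, rfl⟩
  exact ⟨_, (nat_act N M z).symm⟩

theorem ZZ_perf (z : ZZ) : ¬ IsOpen ({z} : Set ZZ) := by
  intro h
  obtain ⟨w, hw, N, M, hw'⟩ := mem_closure_iff.1 (dense_nat (phi z) z) _ h rfl
  rw [Set.mem_singleton_iff.1 hw] at hw'
  have h1 : (psi ^ M) (phi z) = phi ((psi ^ M) z) := by
    rw [← hmul, ← hmul, (phi_psi.pow_right M).eq]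
  rw [h1, ← hmul (phi ^ N), ← pow_succ, nat_act] at hw'
  have := act0_free _ _ hw'.symm
  have := congrArg (fun t => (Multiplicative.toAdd t).1) this
  simp at this
  omega

def cc : ℤ ⊕ ℤ ⊕ Bool → ZZ → Bool
  | .inl n, z => z.1.1 n
  | .inr (.inl n), z => z.2.1.1 n
  | .inr (.inr false), z => decide (z.2.2.1 = 1)
  | .inr (.inr true), z => decide (z.2.2.2 = 1)

theorem cc_cont (i) : Continuous (cc i) := by
  have hd : Continuous (fun a : ZMod 2 => decide (a = 1)) := continuous_of_discreteTopology
  rcases i with n | n | b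
  · exact (coord_cont n).comp continuous_fst
  · exact (coord_cont n).comp (continuous_fst.comp continuous_snd)
  · cases b
    · exact hd.comp (continuous_fst.comp (continuous_snd.comp continuous_snd))
    · exact hd.comp (continuous_snd.comp (continuous_snd.comp continuous_snd))

theorem cc_sep (z z' : ZZ) (h : ∀ i, cc i z = cc i z') : z = z' := by
  obtain ⟨x, y, g⟩ := z
  obtain ⟨x', y', g'⟩ := z'
  have hg : ∀ a b : GG, decide (a.1 = 1) = decide (b.1 = 1) → decide (a.2 = 1) = decide (b.2 = 1) →
    a = b := by decide
  refine Prod.ext (Subtype.ext (funext fun n => h (.inl n))) (Prod.ext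
    (Subtype.ext (funext fun n => h (.inr (.inl n)))) (hg _ _ (h (.inr (.inr false)))
      (h (.inr (.inr true)))))

theorem ZZ_cantor : Nonempty (ZZ ≃ₜ (ℕ → Bool)) := by
  obtain ⟨q, hq⟩ := exists_surjective_nat (ℤ ⊕ ℤ ⊕ Bool)
  haveI : Nonempty ZZ := ⟨(⟨x0, x0_mem⟩, ⟨x0, x0_mem⟩, 0)⟩
  refine brouwer (fun n => cc (q n)) (fun n => cc_cont _) (fun z z' h => cc_sep z z' fun i => ?_)
    ZZ_perf
  obtain ⟨n, rfl⟩ := hq i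
  exact h n

end System

section Functional

def xs : XS := ⟨x0, x0_mem⟩

def pt (a b : ℕ) (g : GG) : ZZ := (TT a xs, TT b xs, g + ss x0 a + ss x0 b)

theorem phi_pt (a b : ℕ) (g : GG) : phi (pt a b g) = pt (a + 1) b g := by
  rw [phi_apply]
  simp only [pt, TT_TT, ss_succ]
  refine Prod.ext ?_ (Prod.ext rfl ?_)
  · simp [add_comm]
  · simp only [TT, xs, zero_add]; abel

theorem sig_pt (a b : ℕ) (g : GG) : sig (pt a b g) = pt b a g := by
  show (TT b xs, TT a xs, g + ss x0 a + ss x0 b) = (TT b xs, TT a xs, g + ss x0 b + ss x0 a)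
  rw [add_right_comm]

def bb (i j : Bool) (g : GG) : ZMod 2 := if i && j then g.2 else if i || j then g.1 else 0

theorem bb_symm (i j : Bool) (g : GG) : bb i j g = bb j i g := by
  cases i <;> cases j <;> rfl

def nu (N : Bool → ℕ) (F : ZZ → ℤ) : ZMod 2 :=
  ∑ i, ∑ j, ∑ a ∈ Finset.range (N i), ∑ b ∈ Finset.range (N j), ∑ g : GG,
    bb i j g * ((F (pt a b g) : ℤ) : ZMod 2)

theorem nu_add (N : Bool → ℕ) (F G : ZZ → ℤ) : nu N (F + G) = nu N F + nu N G := by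
  simp only [nu, Pi.add_apply, Int.cast_add, mul_add, Finset.sum_add_distrib]

theorem nu_zero (N : Bool → ℕ) : nu N 0 = 0 := by simp [nu]

theorem nu_neg (N : Bool → ℕ) (F : ZZ → ℤ) : nu N (-F) = - nu N F := by
  simp only [nu, Pi.neg_apply, Int.cast_neg, mul_neg, Finset.sum_neg_distrib]

theorem nu_sig (N : Bool → ℕ) (F : ZZ → ℤ) : nu N (F ∘ sig) = nu N F := by
  simp only [nu, Function.comp, sig_pt]
  rw [Finset.sum_comm]
  refine Finset.sum_congr rfl fun j _ => Finset.sum_congr rfl fun i _ => ?_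
  rw [Finset.sum_comm]
  simp only [bb_symm i j]

theorem bb_cob : ∀ (j : Bool) (K : GG → ZMod 2),
    ∑ i, ∑ g : GG, bb i j g * (K (g + ee i) - K g) = 0 := by
  intro j K
  have h : ∀ (j : Bool) (p q r s : ZMod 2) (K : GG → ZMod 2), K (0,0) = p → K (0,1) = q →
    K (1,0) = r → K (1,1) = s → ∑ i, ∑ g : GG, bb i j g * (K (g + ee i) - K g) = 0 := by
    intro j p q r s K hp hq hr hs
    have e1 : ∀ F : GG → ZMod 2, ∑ g : GG, F g = F (0,0) + F (0,1) + F (1,0) + F (1,1) := by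
      intro F
      rw [Fintype.sum_prod_type]
      show ∑ x : Fin 2, ∑ y : Fin 2, F (x, y) = _
      simp only [Fin.sum_univ_two]
      exact (add_assoc _ _ _).symm
    simp only [Fintype.sum_bool, e1]
    have a1 : ((0,0) : GG) + ee true = (0,1) := by decide
    have a2 : ((0,1) : GG) + ee true = (0,0) := by decide
    have a3 : ((1,0) : GG) + ee true = (1,1) := by decide
    have a4 : ((1,1) : GG) + ee true = (1,0) := by decide
    have b1 : ((0,0) : GG) + ee false = (1,0) := by decide
    have b2 : ((0,1) : GG) + ee false = (1,1) := by decide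
    have b3 : ((1,0) : GG) + ee false = (0,0) := by decide
    have b4 : ((1,1) : GG) + ee false = (0,1) := by decide
    rw [a1, a2, a3, a4, b1, b2, b3, b4, hp, hq, hr, hs]
    clear hp hq hr hs
    revert j p q r s
    decide
  exact h j _ _ _ _ K rfl rfl rfl rfl

theorem nu_phi (N : Bool → ℕ) (hN : ∀ i, ss x0 (N i) = ee i) (k : ZZ → ℤ)
    (hk : ∀ i w, k (TT (N i) xs, w) = k (xs, w)) : nu N (k ∘ phi - k) = 0 := by
  simp only [nu, Pi.sub_apply, Function.comp, phi_pt, Int.cast_sub]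
  rw [Finset.sum_comm]
  refine Finset.sum_eq_zero fun j _ => ?_
  have h1 : ∀ i, ∑ a ∈ Finset.range (N i), ∑ b ∈ Finset.range (N j), ∑ g : GG,
      bb i j g * (((k (pt (a+1) b g) : ℤ) : ZMod 2) - ((k (pt a b g) : ℤ) : ZMod 2)) =
      ∑ b ∈ Finset.range (N j), ∑ g : GG, bb i j g *
        (((k (xs, TT b xs, g + ee i + ss x0 b) : ℤ) : ZMod 2)
          - ((k (xs, TT b xs, g + ss x0 b) : ℤ) : ZMod 2)) := by
    intro i
    rw [Finset.sum_comm]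
    refine Finset.sum_congr rfl fun b _ => ?_
    rw [Finset.sum_comm]
    refine Finset.sum_congr rfl fun g _ => ?_
    rw [← Finset.mul_sum, Finset.sum_range_sub (fun a => ((k (pt a b g) : ℤ) : ZMod 2))]
    simp only [pt, hk, hN]
    simp [ss, TT_zero]
  simp only [h1]
  rw [Finset.sum_comm]
  refine Finset.sum_eq_zero fun b _ => ?_
  exact bb_cob j (fun g => ((k (xs, TT b xs, g + ss x0 b) : ℤ) : ZMod 2))

theorem exists_NN : ∃ NN : ℕ → Bool → ℕ, (∀ r i, ss x0 (NN r i) = ee i) ∧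
    ∀ i, Filter.Tendsto (fun r => TT (NN r i) xs) Filter.atTop (nhds xs) := by
  choose NN h1 h2 using fun (r : ℕ) (i : Bool) => reach x0_mem x0_mem (ee i) r
  exact ⟨NN, h2, fun i => tendsto_XS fun r => h1 r i⟩

def EE (NN : ℕ → Bool → ℕ) : AddSubgroup (ZZ → ℤ) where
  carrier := {h | ∀ᶠ r in Filter.atTop, nu (NN r) h = 0}
  zero_mem' := Filter.Eventually.of_forall fun r => nu_zero _
  add_mem' := by
    intro a b ha hb
    filter_upwards [ha, hb] with r h1 h2
    rw [nu_add, h1, h2, add_zero]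
  neg_mem' := by
    intro a ha
    filter_upwards [ha] with r h1
    rw [nu_neg, h1, neg_zero]

theorem mem_EE (NN : ℕ → Bool → ℕ) (h : ZZ → ℤ) :
    h ∈ EE NN ↔ ∀ᶠ r in Filter.atTop, nu (NN r) h = 0 := Iff.rfl

theorem EE_phi (NN : ℕ → Bool → ℕ) (h1 : ∀ r i, ss x0 (NN r i) = ee i)
    (h2 : ∀ i, Filter.Tendsto (fun r => TT (NN r i) xs) Filter.atTop (nhds xs))
    (k : ZZ → ℤ) (hk : Continuous k) : k ∘ phi - k ∈ EE NN := by
  have h3 : ∀ᶠ x in nhds xs, ∀ w ∈ (Set.univ : Set (XS × GG)), k (x, w) = k (xs, w) := by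
    refine IsCompact.eventually_forall_of_forall_eventually isCompact_univ fun w _ => ?_
    have hc : Continuous fun p : XS × (XS × GG) => k (p.1, p.2) - k (xs, p.2) := by fun_prop
    have := hc.continuousAt (x := (xs, w))
    have h0 : ∀ᶠ p in nhds ((xs, w) : XS × (XS × GG)), k (p.1, p.2) - k (xs, p.2) ∈ ({0} : Set ℤ) :=
      this ((isOpen_discrete _).mem_nhds (by simp))
    filter_upwards [h0] with p hp
    exact sub_eq_zero.1 hp
  rw [mem_EE]
  filter_upwards [(h2 true).eventually h3, (h2 false).eventually h3] with r ht hf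
  refine nu_phi _ (h1 r) k fun i w => ?_
  cases i
  · exact hf w trivial
  · exact ht w trivial

theorem EE_psi (NN : ℕ → Bool → ℕ) (h1 : ∀ r i, ss x0 (NN r i) = ee i)
    (h2 : ∀ i, Filter.Tendsto (fun r => TT (NN r i) xs) Filter.atTop (nhds xs))
    (k : ZZ → ℤ) (hk : Continuous k) : k ∘ psi - k ∈ EE NN := by
  have := EE_phi NN h1 h2 (k ∘ sig) (hk.comp sig.continuous)
  rw [mem_EE] at this ⊢
  filter_upwards [this] with r hr
  rw [← nu_sig] at hr
  exact hr

def stab (E : AddSubgroup (ZZ → ℤ)) : Subgroup (ZZ ≃ₜ ZZ) where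
  carrier := {h | ∀ k : ZZ → ℤ, Continuous k → k ∘ h - k ∈ E}
  one_mem' := by
    intro k _
    have : k ∘ (1 : ZZ ≃ₜ ZZ) - k = 0 := by funext z; simp [hone]
    rw [this]; exact E.zero_mem
  mul_mem' := by
    intro a b ha hb k hk
    have : k ∘ (a * b : ZZ ≃ₜ ZZ) - k = ((k ∘ a) ∘ b - k ∘ a) + (k ∘ a - k) := by
      funext z; simp [hmul]
    rw [this]
    exact E.add_mem (hb _ (hk.comp a.continuous)) (ha k hk)
  inv_mem' := by
    intro a ha k hk
    have h := ha (k ∘ (a⁻¹ : ZZ ≃ₜ ZZ)) (hk.comp (a⁻¹ : ZZ ≃ₜ ZZ).continuous)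
    have : k ∘ (a⁻¹ : ZZ ≃ₜ ZZ) - k = -((k ∘ (a⁻¹ : ZZ ≃ₜ ZZ)) ∘ a - k ∘ (a⁻¹ : ZZ ≃ₜ ZZ)) := by
      funext z
      have : (a⁻¹ : ZZ ≃ₜ ZZ) (a z) = z := a.symm_apply_apply z
      simp [this]
    rw [this]
    exact E.neg_mem h

theorem EE_act (NN : ℕ → Bool → ℕ) (h1 : ∀ r i, ss x0 (NN r i) = ee i)
    (h2 : ∀ i, Filter.Tendsto (fun r => TT (NN r i) xs) Filter.atTop (nhds xs))
    (γ) (k : ZZ → ℤ) (hk : Continuous k) : k ∘ act0 γ - k ∈ EE NN := by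
  have : act0 γ ∈ stab (EE NN) := by
    rw [act0_apply]
    exact mul_mem (zpow_mem (show phi ∈ stab (EE NN) from EE_phi NN h1 h2) _)
      (zpow_mem (show psi ∈ stab (EE NN) from EE_psi NN h1 h2) _)
  exact this k hk

def u1 (b : Bool) : ℤ := if b then 0 else 1
def u2 (b : Bool) : ℤ := if b then 1 else 0

def ff (z : ZZ) : ℤ := u1 (z.1.1 0) * u2 (z.2.1.1 0) * ((z.2.2.1.val : ℤ) - (z.2.2.2.val : ℤ))
def aa (z : ZZ) : ℤ := u1 (z.1.1 0) * (z.2.2.2.val : ℤ)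
def ab (z : ZZ) : ℤ := - (u2 (z.2.1.1 0) * (z.2.2.1.val : ℤ))

theorem fin_cont (F : Bool → Bool → GG → ℤ) :
    Continuous fun z : ZZ => F (z.1.1 0) (z.2.1.1 0) z.2.2 := by
  have hF : Continuous fun p : Bool × Bool × GG => F p.1 p.2.1 p.2.2 :=
    continuous_of_discreteTopology
  exact hF.comp (((coord_cont 0).comp continuous_fst).prodMk
    (((coord_cont 0).comp (continuous_fst.comp continuous_snd)).prodMk
      (continuous_snd.comp continuous_snd)))

theorem ff_cont : Continuous ff :=
  fin_cont fun p q g => u1 p * u2 q * ((g.1.val : ℤ) - (g.2.val : ℤ))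
theorem aa_cont : Continuous aa := fin_cont fun p _ g => u1 p * (g.2.val : ℤ)
theorem ab_cont : Continuous ab := fin_cont fun _ q g => - (u2 q * (g.1.val : ℤ))

theorem two_ff (z : ZZ) : 2 * ff z = (aa (psi z) - aa z) + (ab (phi z) - ab z) := by
  have : ∀ (p q : Bool) (g : GG), 2 * (u1 p * u2 q * ((g.1.val : ℤ) - (g.2.val : ℤ))) =
      (u1 p * ((g + ee q).2.val : ℤ) - u1 p * (g.2.val : ℤ)) +
      (- (u2 q * ((g + ee p).1.val : ℤ)) - - (u2 q * (g.1.val : ℤ))) := by decide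
  exact this _ _ _

theorem ff_sum : ∀ (i j p q : Bool) (t : GG),
    ∑ g : GG, bb i j g * ((u1 p * u2 q * (((g + t).1.val : ℤ) - ((g + t).2.val : ℤ)) : ℤ) : ZMod 2)
      = (ee p).1 * (ee q).2 * (if i || j then 1 else 0) := by decide

theorem nu_ff (N : Bool → ℕ) (hN : ∀ i, ss x0 (N i) = ee i) : nu N ff = 1 := by
  have h1 : ∀ i j a b, ∑ g : GG, bb i j g * ((ff (pt a b g) : ℤ) : ZMod 2)
      = (ee (x0 a)).1 * (ee (x0 b)).2 * (if i || j then 1 else 0) := by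
    intro i j a b
    rw [← ff_sum i j (x0 a) (x0 b) (ss x0 a + ss x0 b)]
    refine Finset.sum_congr rfl fun g _ => ?_
    simp only [ff, pt, TT, xs, zero_add, add_assoc]
  simp only [nu, h1]
  have h2 : ∀ i, ∑ a ∈ Finset.range (N i), (ee (x0 a)).1 = (ee i).1 := by
    intro i; rw [← hN i, ss, Prod.fst_sum]
  have h3 : ∀ i, ∑ a ∈ Finset.range (N i), (ee (x0 a)).2 = (ee i).2 := by
    intro i; rw [← hN i, ss, Prod.snd_sum]
  have h4 : ∀ i j, ∑ a ∈ Finset.range (N i), ∑ b ∈ Finset.range (N j),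
      (ee (x0 a)).1 * (ee (x0 b)).2 * (if i || j then (1 : ZMod 2) else 0) =
      (ee i).1 * (ee j).2 * (if i || j then 1 else 0) := by
    intro i j
    rw [← h2 i, ← h3 j, Finset.sum_mul_sum, Finset.sum_mul]
    simp only [Finset.sum_mul]
  simp only [h4]
  decide

theorem ff_not_mem (NN : ℕ → Bool → ℕ) (h1 : ∀ r i, ss x0 (NN r i) = ee i) : ff ∉ EE NN := by
  intro h
  obtain ⟨r, hr⟩ := ((mem_EE _ _).1 h).exists
  rw [nu_ff _ (h1 r)] at hr
  exact one_ne_zero hr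

end Functional

section Assembly

def conjAct (e : ZZ ≃ₜ Cantor) : Multiplicative (ℤ × ℤ) →* (Cantor ≃ₜ Cantor) where
  toFun γ := (e.symm.trans (act0 γ)).trans e
  map_one' := by
    refine Homeomorph.ext fun x => ?_
    simp [hone]
  map_mul' a b := by
    refine Homeomorph.ext fun x => ?_
    simp [hmul]

theorem conjAct_apply (e : ZZ ≃ₜ Cantor) (γ) (x : Cantor) :
    conjAct e γ x = e (act0 γ (e.symm x)) := rfl

def pullE (e : ZZ ≃ₜ Cantor) (E : AddSubgroup (ZZ → ℤ)) : AddSubgroup (Cantor → ℤ) where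
  carrier := {h | h ∘ e ∈ E}
  zero_mem' := E.zero_mem
  add_mem' ha hb := E.add_mem ha hb
  neg_mem' ha := E.neg_mem ha

end Assembly

/-- There is a free minimal action `α` of `ℤ²` on the Cantor space such
that `⟦α⟧` admits no dense locally finite subgroup. -/
theorem stmt4 :
    ∃ α : Multiplicative (ℤ × ℤ) →* (Cantor ≃ₜ Cantor),
      (∀ (γ : Multiplicative (ℤ × ℤ)) (x : Cantor), α γ x = x → γ = 1) ∧
      (∀ x : Cantor, Dense (Set.range fun γ : Multiplicative (ℤ × ℤ) => α γ x)) ∧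
      ¬ HasDenseLocallyFiniteSubgroup α := by
  obtain ⟨e⟩ := ZZ_cantor
  obtain ⟨NN, h1, h2⟩ := exists_NN
  refine ⟨conjAct e, ?_, ?_, ?_⟩
  · intro γ x h
    rw [conjAct_apply] at h
    refine act0_free γ (e.symm x) ?_
    rw [← e.symm_apply_apply (act0 γ (e.symm x)), h]
  · intro x
    have := e.surjective.denseRange.dense_image e.continuous (act0_min (e.symm x))
    refine this.mono ?_
    rintro _ ⟨_, ⟨γ, rfl⟩, rfl⟩
    exact ⟨γ, rfl⟩
  · intro hD
    have key := torsion_free (conjAct e) (pullE e (EE NN)) (fun γ k hk => ?_)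
      (ff ∘ e.symm) (aa ∘ e.symm) (ab ∘ e.symm) (ff_cont.comp e.symm.continuous)
      (aa_cont.comp e.symm.continuous) (ab_cont.comp e.symm.continuous)
      (Multiplicative.ofAdd (0, 1)) (Multiplicative.ofAdd (1, 0)) (fun x => ?_) hD
    · refine ff_not_mem NN h1 ?_
      have h3 : (ff ∘ e.symm) ∘ e ∈ EE NN := key
      have h4 : (ff ∘ e.symm) ∘ e = ff := by funext z; simp
      rwa [h4] at h3
    · have h3 := EE_act NN h1 h2 γ (k ∘ e) (hk.comp e.continuous)
      show (k ∘ conjAct e γ - k) ∘ e ∈ EE NN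
      have h4 : (k ∘ conjAct e γ - k) ∘ e = (k ∘ e) ∘ act0 γ - k ∘ e := by
        funext z; simp [conjAct_apply]
      rwa [h4]
    · have h3 := two_ff (e.symm x)
      simpa [conjAct_apply, act0_apply] using h3
end
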